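/- arXiv:2503.19603 — 4 statements merged into one kernel-verified Lean document; each statement's English description precedes it below -/
import Mathlib

section
/- Let q be an odd prime power, let k ≥ 2, and let f ∈ F_q[x_1,…,x_k] be an admissible symmetric polynomial of total degree d. Let X be the set of tuples (u_2, u_3, …, u_k) ∈ F_q^{k−1} such that the univariate polynomial f(x, u_2, u_3, …, u_k) ∈ F_q[x] can be written as c·h(x)² for some c ∈ F_q and some monic polynomial h(x) ∈ F_q[x]. Then |X| ≤ (d² + d)·q^{k−2}. -/
open MvPolynomial

/-- Substitute: variable `0` of `f` is kept as the polynomial indeterminate `X`, and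
variable `j+1` is replaced by `u j`.  This produces the univariate polynomial
`f(x, u_2, …, u_k)`. -/
noncomputable def substX {F : Type*} [Field F] {k : ℕ} (f : MvPolynomial (Fin k) F)
    (u : Fin (k - 1) → F) : Polynomial F :=
  MvPolynomial.aeval (fun i : Fin k =>
    if h : (i : ℕ) = 0 then (Polynomial.X : Polynomial F)
    else Polynomial.C (u ⟨(i : ℕ) - 1, by have := i.isLt; omega⟩)) f

/-- `f` is admissible: not a constant multiple of a square, and the coefficients of `f` as
a polynomial in `x_1` have no common zero over the algebraic closure. -/
def Admissible {F : Type*} [Field F] {k : ℕ} (f : MvPolynomial (Fin k) F) : Prop :=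
  (¬ ∃ (c : F) (g : MvPolynomial (Fin k) F), f = MvPolynomial.C c * g ^ 2) ∧
  ∀ v : Fin (k - 1) → AlgebraicClosure F,
    substX (MvPolynomial.map (algebraMap F (AlgebraicClosure F)) f) v ≠ 0


def TDle {F : Type*} [Field F] {n : ℕ} (A : Polynomial (MvPolynomial (Fin n) F)) (a : ℕ) : Prop :=
  ∀ j, A.coeff j ≠ 0 → (A.coeff j).totalDegree + j ≤ a

lemma TDle.natDegree_le {F : Type*} [Field F] {n : ℕ} {A : Polynomial (MvPolynomial (Fin n) F)}
    {a : ℕ} (h : TDle A a) : A.natDegree ≤ a := by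
  by_cases hA : A = 0
  · simp [hA]
  · have := h A.natDegree (by simpa using hA)
    omega

lemma resultant_td {F : Type*} [Field F] {N : ℕ} {A B : Polynomial (MvPolynomial (Fin N) F)}
    {a b : ℕ} (hA : TDle A a) (hB : TDle B b) : (A.resultant B).totalDegree ≤ a * b := by
  have hm := hA.natDegree_le
  have hn := hB.natDegree_le
  unfold Polynomial.resultant
  generalize A.natDegree = m at *
  generalize B.natDegree = n at *
  rw [Matrix.det_apply]
  apply totalDegree_finsetSum_le
  intro σ _
  refine (totalDegree_smul_le _ _).trans ?_
  by_cases h0 : ∏ i, Polynomial.sylvester A B m n (σ i) i = 0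
  · simp [h0]
  have h1 : ∀ i, Polynomial.sylvester A B m n (σ i) i ≠ 0 := by
    intro i
    exact (Finset.prod_ne_zero_iff.mp h0) i (Finset.mem_univ _)
  refine (totalDegree_finsetProd _ _).trans ?_
  have e1 : ∀ j : Fin m, (Polynomial.sylvester A B m n (σ (Fin.castAdd n j)) (Fin.castAdd n j)).totalDegree
      + (σ (Fin.castAdd n j) : ℕ) ≤ b + j := by
    intro j
    have := h1 (Fin.castAdd n j)
    simp only [Polynomial.sylvester, Matrix.of_apply, Fin.addCases_left] at this ⊢
    split_ifs at this ⊢ with h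
    · have h3 := hB _ this
      have := h.1
      omega
    · exact absurd rfl this
  have e2 : ∀ j : Fin n, (Polynomial.sylvester A B m n (σ (Fin.natAdd m j)) (Fin.natAdd m j)).totalDegree
      + (σ (Fin.natAdd m j) : ℕ) ≤ a + j := by
    intro j
    have := h1 (Fin.natAdd m j)
    simp only [Polynomial.sylvester, Matrix.of_apply, Fin.addCases_right] at this ⊢
    split_ifs at this ⊢ with h
    · have h3 := hA _ this
      have := h.1
      omega
    · exact absurd rfl this
  have s : ∑ i, ((σ i : Fin (m + n)) : ℕ) = ∑ i : Fin (m + n), (i : ℕ) :=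
    Equiv.sum_comp σ (fun i : Fin (m + n) => (i : ℕ))
  have s1 := Finset.sum_le_sum (fun j (_ : j ∈ Finset.univ) => e1 j)
  have s2 := Finset.sum_le_sum (fun j (_ : j ∈ Finset.univ) => e2 j)
  rw [Fin.sum_univ_add] at s ⊢
  rw [Fin.sum_univ_add] at s
  simp only [Finset.sum_add_distrib, Finset.sum_const, Finset.card_univ, Fintype.card_fin,
    smul_eq_mul, Fin.val_castAdd, Fin.val_natAdd] at s s1 s2 ⊢
  obtain ⟨a', rfl⟩ := Nat.exists_eq_add_of_le hm
  obtain ⟨b', rfl⟩ := Nat.exists_eq_add_of_le hn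
  nlinarith [Nat.zero_le (a' * b')]

lemma resultant_ne_zero_of_irreducible {R : Type*} [CommRing R] [IsDomain R]
    [UniqueFactorizationMonoid R] {P B : Polynomial R} (hP : Irreducible P)
    (hd : P.natDegree ≠ 0) (hB : ¬ P ∣ B) : P.resultant B ≠ 0 := by
  classical
  let _ : NormalizedGCDMonoid R :=
    Classical.choice (inferInstance : Nonempty (NormalizedGCDMonoid R))
  have hprim : P.IsPrimitive := hP.isPrimitive hd
  intro h0
  let K := FractionRing R
  have hinj : Function.Injective (algebraMap R K) := IsFractionRing.injective R K
  have h1 := Polynomial.resultant_map_map P B P.natDegree B.natDegree (algebraMap R K)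
  rw [h0, map_zero] at h1
  have h2 : (P.map (algebraMap R K)).resultant (B.map (algebraMap R K)) = 0 := by
    rw [Polynomial.natDegree_map_eq_of_injective hinj, Polynomial.natDegree_map_eq_of_injective hinj]
    exact h1
  rw [Polynomial.resultant_eq_zero_iff] at h2
  apply h2.2
  have hirr := (hprim.irreducible_iff_irreducible_map_fraction_map (K := K)).1 hP
  rw [hirr.coprime_iff_not_dvd]
  rwa [← hprim.dvd_iff_fraction_map_dvd_fraction_map K]

lemma coprime_of_resultant {R S : Type*} [CommRing R] [Field S] (φ : R →+* S)
    {P B : Polynomial R} (hd : P.natDegree ≠ 0) (h : φ (P.resultant B) ≠ 0) :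
    IsCoprime (P.map φ) (B.map φ) := by
  obtain ⟨x, y, -, -, e⟩ := Polynomial.exists_mul_add_mul_eq_C_resultant P B le_rfl le_rfl (Or.inl hd)
  have e' := congrArg (Polynomial.map φ) e
  simp only [Polynomial.map_add, Polynomial.map_mul, Polynomial.map_C] at e'
  refine ⟨Polynomial.C (φ (P.resultant B))⁻¹ * x.map φ, Polynomial.C (φ (P.resultant B))⁻¹ * y.map φ, ?_⟩
  calc _ = Polynomial.C (φ (P.resultant B))⁻¹ * (P.map φ * x.map φ + B.map φ * y.map φ) := by ring
    _ = _ := by rw [e', ← Polynomial.C_mul, inv_mul_cancel₀ h, Polynomial.C_1]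

lemma exists_contract {R : Type*} [CommRing R] [IsDomain R] (p : ℕ) [Fact p.Prime] [CharP R p]
    (n : ℕ) : ∀ P : Polynomial R, P.natDegree = n → Irreducible P → P.natDegree ≠ 0 →
    ∃ (e : ℕ) (Q : Polynomial R), P = Polynomial.expand R (p ^ e) Q ∧ Irreducible Q ∧
      Q.natDegree ≠ 0 ∧ Polynomial.derivative Q ≠ 0 := by
  induction n using Nat.strong_induction_on with
  | _ n ih =>
    intro P hn hP h0
    by_cases hder : Polynomial.derivative P = 0
    · have hp := (Fact.out : p.Prime)
      have e := Polynomial.expand_contract p hder hp.ne_zero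
      have hnd : P.natDegree = (Polynomial.contract p P).natDegree * p := by
        rw [← Polynomial.natDegree_expand, e]
      have hc0 : (Polynomial.contract p P).natDegree ≠ 0 := by
        intro h; rw [h] at hnd; omega
      have hlt : (Polynomial.contract p P).natDegree < n := by
        have := hp.two_le
        rw [← hn, hnd]
        nlinarith [Nat.pos_of_ne_zero hc0]
      have hirr : Irreducible (Polynomial.contract p P) := by
        apply Polynomial.of_irreducible_expand hp.ne_zero
        rwa [e]
      obtain ⟨e', Q, h1, h2, h3, h4⟩ := ih _ hlt _ rfl hirr hc0
      refine ⟨e' + 1, Q, ?_, h2, h3, h4⟩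
      rw [pow_succ', Polynomial.expand_mul, ← h1, e]
    · exact ⟨0, P, by simp, hP, h0, hder⟩

lemma odd_part {R : Type*} [CommRing R] [IsDomain R] [UniqueFactorizationMonoid R] (f : R) :
    f = 0 ∨ (∃ u g : R, IsUnit u ∧ f = u * g ^ 2) ∨
      ∃ (P S : R) (m : ℕ), Prime P ∧ Odd m ∧ f = P ^ m * S ∧ ¬ P ∣ S := by
  induction f using UniqueFactorizationMonoid.induction_on_coprime with
  | h0 => left; rfl
  | h1 hx => right; left; exact ⟨_, 1, hx, by simp⟩
  | @hpr p i hp =>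
    right
    rcases Nat.even_or_odd i with ⟨j, rfl⟩ | h
    · left; exact ⟨1, p ^ j, isUnit_one, by ring⟩
    · right; exact ⟨p, 1, i, hp, h, by simp, fun h => hp.not_isUnit (isUnit_of_dvd_one h)⟩
  | @hcp x y hxy hx hy =>
    rcases hx with rfl | hx
    · left; simp
    rcases hy with rfl | hy
    · left; simp
    right
    rcases hx with ⟨u, g, hu, rfl⟩ | ⟨P, S, m, hP, hm, rfl, hS⟩
    · rcases hy with ⟨v, g', hv, rfl⟩ | ⟨P, S, m, hP, hm, rfl, hS⟩
      · left; exact ⟨u * v, g * g', hu.mul hv, by ring⟩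
      · right
        refine ⟨P, u * g ^ 2 * S, m, hP, hm, by ring, ?_⟩
        intro h
        rcases hP.dvd_or_dvd h with h | h
        · exact hP.not_isUnit (hxy h (Dvd.dvd.mul_right (dvd_pow_self _ hm.pos.ne') _))
        · exact hS h
    · right
      refine ⟨P, S * y, m, hP, hm, by ring, ?_⟩
      intro h
      rcases hP.dvd_or_dvd h with h | h
      · exact hS h
      · exact hP.not_isUnit (hxy (Dvd.dvd.mul_right (dvd_pow_self _ hm.pos.ne') _) h)

lemma square_contra {F : Type*} [Field F] {Q S h : Polynomial F} {c : F} {M : ℕ} (hM : Odd M)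
    (hQ : Squarefree Q) (hQu : ¬ IsUnit Q) (hQS : IsCoprime Q S)
    (e : Q ^ M * S = Polynomial.C c * h ^ 2) : False := by
  obtain ⟨π, hπ, hπQ⟩ := WfDvdMonoid.exists_irreducible_factor hQu hQ.ne_zero
  have hpr := hπ.prime
  have hπS : ¬ π ∣ S := fun h => hπ.not_isUnit (hQS.isUnit_of_dvd' hπQ h)
  have h1 : emultiplicity π Q = 1 := by
    apply le_antisymm
    · rcases (squarefree_iff_emultiplicity_le_one Q).1 hQ π with h | h
      · exact h
      · exact absurd h hπ.not_isUnit
    · have := pow_dvd_iff_le_emultiplicity (a := π) (b := Q) (k := 1)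
      simpa using this.1 (by simpa using hπQ)
  have hS0 : S ≠ 0 := by rintro rfl; exact hπS (dvd_zero _)
  have hne : Q ^ M * S ≠ 0 := mul_ne_zero (pow_ne_zero _ hQ.ne_zero) hS0
  have hc : c ≠ 0 := by rintro rfl; rw [e] at hne; simp at hne
  have hh : h ≠ 0 := by rintro rfl; rw [e] at hne; simp at hne
  have hCc : emultiplicity π (Polynomial.C c) = 0 := by
    rw [emultiplicity_eq_zero]
    intro hd
    exact hπ.not_isUnit (isUnit_of_dvd_unit hd (Polynomial.isUnit_C.2 (isUnit_iff_ne_zero.2 hc)))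
  have e2 := congrArg (emultiplicity π) e
  rw [emultiplicity_mul hpr, emultiplicity_mul hpr, emultiplicity_pow hpr, emultiplicity_pow hpr, h1,
    emultiplicity_eq_zero.2 hπS, hCc] at e2
  have hf : FiniteMultiplicity π h := FiniteMultiplicity.of_prime_left hpr hh
  rw [hf.emultiplicity_eq_multiplicity] at e2
  obtain ⟨t, rfl⟩ := hM
  simp only [mul_one, add_zero, zero_add] at e2
  have e3 : 2 * t + 1 = 2 * multiplicity π h := by exact_mod_cast e2
  omega

lemma substX_map_eq {F K : Type*} [Field F] [Field K] {N : ℕ} (φ : F →+* K)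
    (f : MvPolynomial (Fin (N + 1)) F) (v : Fin N → K) :
    substX (k := N + 1) (MvPolynomial.map φ f) v =
      (finSuccEquiv F N f).map (eval₂Hom φ v) := by
  induction f using MvPolynomial.induction_on with
  | C a =>
    simp [substX, finSuccEquiv_apply]
  | add p q hp hq => 
    simp only [substX, map_add, Polynomial.map_add] at hp hq ⊢
    rw [hp, hq]
  | mul_X p i hp =>
    have : substX (k := N + 1) (MvPolynomial.map φ (X i)) v =
      (finSuccEquiv F N (X i)).map (eval₂Hom φ v) := by
      refine Fin.cases ?_ (fun j => ?_) i
      · simp [substX, finSuccEquiv_X_zero]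
      · rw [finSuccEquiv_X_succ]
        simp [substX]
    simp only [substX, map_mul, Polynomial.map_mul] at hp this ⊢
    rw [hp, this]

lemma substX_eq {F : Type*} [Field F] {N : ℕ}
    (f : MvPolynomial (Fin (N + 1)) F) (v : Fin N → F) :
    substX (k := N + 1) f v = (finSuccEquiv F N f).map (eval v) := by
  have := substX_map_eq (RingHom.id F) f v
  rw [MvPolynomial.map_id] at this
  exact this

lemma exists_zero {F : Type*} [Field F] {N : ℕ} (w : MvPolynomial (Fin N) F) (hw : ¬ IsUnit w) :
    ∃ v : Fin N → AlgebraicClosure F, eval₂Hom (algebraMap F (AlgebraicClosure F)) v w = 0 := by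
  obtain ⟨M, hM, hle⟩ := Ideal.exists_le_maximal (Ideal.span {w})
    (by rwa [Ne, Ideal.span_singleton_eq_top])
  obtain ⟨x, hx⟩ := eq_vanishingIdeal_singleton_of_isMaximal (AlgebraicClosure F) hM
  refine ⟨x, ?_⟩
  have : w ∈ M := hle (Ideal.mem_span_singleton_self w)
  rw [hx, mem_vanishingIdeal_singleton_iff] at this
  exact this

lemma count_zeros {F : Type*} [Field F] [Fintype F] {n : ℕ} {T : MvPolynomial (Fin (n + 1)) F}
    (hT : T ≠ 0) (s : Set (Fin (n + 1) → F)) (hs : ∀ u ∈ s, eval u T = 0) :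
    s.ncard ≤ T.totalDegree * Fintype.card F ^ n := by
  classical
  have h := schwartz_zippel_totalDegree hT (Finset.univ : Finset F)
  have h1 : s.ncard ≤
    (Finset.filter (fun u => eval u T = 0) (Fintype.piFinset fun _ : Fin (n+1) => (Finset.univ : Finset F))).card := by
    rw [← Set.ncard_coe_finset]
    apply Set.ncard_le_ncard _ (Set.toFinite _)
    intro u hu
    simpa using hs u hu
  refine h1.trans ?_
  have hq : (0 : ℚ≥0) < (Finset.univ : Finset F).card := by
    simp [Fintype.card_pos]
  rw [div_le_div_iff₀ (by positivity) hq, pow_succ, ← mul_assoc] at h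
  have h2 := le_of_mul_le_mul_right h hq
  rw [Finset.card_univ] at h2
  exact_mod_cast h2

lemma td_fin {F : Type*} [Field F] {N : ℕ} (f : MvPolynomial (Fin (N + 1)) F) :
    TDle (finSuccEquiv F N f) f.totalDegree :=
  fun j hj => totalDegree_coeff_finSuccEquiv_add_le f j hj

lemma td_contract {F : Type*} [Field F] {N : ℕ} {Q : Polynomial (MvPolynomial (Fin N) F)} {a r : ℕ}
    (hr : 0 < r) (h : TDle (Polynomial.expand _ r Q) a) : TDle Q a := by
  intro j hj
  have := h (j * r)
  rw [Polynomial.coeff_expand_mul hr] at this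
  have := this hj
  nlinarith

lemma td_derivative {F : Type*} [Field F] {N : ℕ} {Q : Polynomial (MvPolynomial (Fin N) F)} {a : ℕ}
    (h : TDle Q a) : TDle (Polynomial.derivative Q) (a - 1) := by
  intro j hj
  rw [Polynomial.coeff_derivative] at hj ⊢
  have h1 := h (j + 1) (left_ne_zero_of_mul hj)
  have h2 := totalDegree_mul (Q.coeff (j + 1)) ((j : MvPolynomial (Fin N) F) + 1)
  have h3 : ((j : MvPolynomial (Fin N) F) + 1).totalDegree = 0 := by
    have : ((j : MvPolynomial (Fin N) F) + 1) = C ((j : F) + 1) := by simp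
    rw [this, totalDegree_C]
  omega

lemma expand_sep {F : Type*} [Field F] [Fintype F] (p : ℕ) [Fact p.Prime] [CharP F p] (e : ℕ)
    (Q : Polynomial F) (hQ : Q.Separable) :
    ∃ Q' : Polynomial F, Polynomial.expand F (p ^ e) Q = Q' ^ (p ^ e) ∧ Q'.Separable := by
  let σ := (iterateFrobeniusEquiv F p e)
  refine ⟨Q.map (σ.symm : F →+* F), ?_, hQ.map⟩
  rw [← Polynomial.map_iterateFrobenius_expand p, Polynomial.map_expand, Polynomial.map_map]
  have : (iterateFrobenius F p e).comp (σ.symm : F →+* F) = RingHom.id F := by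
    ext x
    exact σ.apply_symm_apply x
  rw [this, Polynomial.map_id]

lemma core {F : Type*} [Field F] [Fintype F] (hq : Odd (Fintype.card F)) (n : ℕ)
    (f : MvPolynomial (Fin (n + 1 + 1)) F) (hadm : Admissible f) :
    Set.ncard {u : Fin (n + 1) → F | ∃ (c : F) (h : Polynomial F),
        h.Monic ∧ substX (k := n + 1 + 1) f u = Polynomial.C c * h ^ 2} ≤
      (f.totalDegree ^ 2 + f.totalDegree) * Fintype.card F ^ n := by
  obtain ⟨hns, hz⟩ := hadm
  rcases odd_part f with h0 | ⟨w, g, hw, hf⟩ | ⟨P, S, m, hP, hm, hf, hS⟩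
  · exact absurd ⟨0, 0, by simp [h0]⟩ hns
  · rw [isUnit_iff_eq_C_of_isReduced] at hw
    obtain ⟨r, -, rfl⟩ := hw
    exact absurd ⟨r, g, hf⟩ hns
  have hf0 : f ≠ 0 := by
    rintro rfl
    exact hns ⟨0, 0, by simp⟩
  let Φ := finSuccEquiv F (n + 1)
  obtain ⟨p, hchar⟩ := CharP.exists F
  have hpp : Fact p.Prime := ⟨CharP.char_is_prime F p⟩
  have hpodd : Odd p := by
    obtain ⟨t, -, ht⟩ := FiniteField.card F p
    rw [ht] at hq
    exact (Nat.odd_pow_iff t.ne_zero).1 hq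
  have hΦf : Φ f = Φ P ^ m * Φ S := by rw [hf, map_mul, map_pow]
  have hPirr : Irreducible (Φ P) := (MulEquiv.irreducible_iff Φ).2 hP.irreducible
  have hPd : (Φ P).natDegree ≠ 0 := by
    intro h
    obtain ⟨w, hw⟩ := Polynomial.natDegree_eq_zero.1 h
    have hwu : ¬ IsUnit w := by
      intro hu
      apply hPirr.not_isUnit
      rw [← hw]
      exact Polynomial.isUnit_C.2 hu
    obtain ⟨v, hv⟩ := exists_zero w hwu
    apply hz v
    refine (substX_map_eq (algebraMap F (AlgebraicClosure F)) f v).trans ?_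
    change (Φ f).map _ = 0
    rw [hΦf, ← hw, Polynomial.map_mul, Polynomial.map_pow, Polynomial.map_C, hv]
    simp [hm.pos.ne']
  have hSdvd : ¬ Φ P ∣ Φ S := by
    rwa [map_dvd_iff Φ]
  obtain ⟨e, Q, hPQ, hQirr, hQd, hQder⟩ := exists_contract p _ (Φ P) rfl hPirr hPd
  have hQder' : ¬ Q ∣ Polynomial.derivative Q := by
    intro h
    have h1 := Polynomial.natDegree_le_of_dvd h hQder
    have h2 := Polynomial.natDegree_derivative_lt hQd
    omega
  have hr1 := resultant_ne_zero_of_irreducible hPirr hPd hSdvd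
  have hr2 := resultant_ne_zero_of_irreducible hQirr hQd hQder'
  have hlc : (Φ P).leadingCoeff ≠ 0 := by simpa using hPirr.ne_zero
  set T1 := (Φ P).resultant (Φ S)
  set T2 := Q.resultant (Polynomial.derivative Q)
  set T3 := (Φ P).leadingCoeff with hT3
  have hS0 : S ≠ 0 := by rintro rfl; simp at hS
  have tP : TDle (Φ P) P.totalDegree := td_fin P
  have tS : TDle (Φ S) S.totalDegree := td_fin S
  have tQ : TDle Q P.totalDegree := by
    apply td_contract (r := p ^ e) (pow_pos hpp.out.pos _)
    rw [← hPQ]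
    exact tP
  have d1 : T1.totalDegree ≤ P.totalDegree * S.totalDegree := resultant_td tP tS
  have d2 : T2.totalDegree ≤ P.totalDegree * (P.totalDegree - 1) :=
    resultant_td tQ (td_derivative tQ)
  have d3 : T3.totalDegree ≤ P.totalDegree := by
    have := tP (Φ P).natDegree hlc
    exact le_of_add_le_left this
  have dS : P.totalDegree + S.totalDegree ≤ f.totalDegree := by
    rw [hf, totalDegree_mul_of_isDomain (pow_ne_zero _ hP.ne_zero) hS0]
    obtain ⟨t, ht⟩ := Nat.exists_eq_add_of_le hm.pos
    rw [ht, pow_add, totalDegree_mul_of_isDomain (pow_ne_zero _ hP.ne_zero) (pow_ne_zero _ hP.ne_zero)]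
    simp
  have hT : T1 * T2 * T3 ≠ 0 := mul_ne_zero (mul_ne_zero hr1 hr2) hlc
  have dT : (T1 * T2 * T3).totalDegree ≤ f.totalDegree ^ 2 + f.totalDegree := by
    have := totalDegree_mul (T1 * T2) T3
    have := totalDegree_mul T1 T2
    have h3 : P.totalDegree * (P.totalDegree - 1) ≤ P.totalDegree * P.totalDegree :=
      Nat.mul_le_mul_left _ (Nat.sub_le _ _)
    have h4 : P.totalDegree * S.totalDegree + P.totalDegree * P.totalDegree ≤ f.totalDegree ^ 2 := by
      nlinarith
    omega
  refine (count_zeros hT _ ?_).trans (Nat.mul_le_mul_right _ dT)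
  rintro u ⟨c, h, -, heq⟩
  by_contra hne
  rw [map_mul, map_mul] at hne
  have n3 := right_ne_zero_of_mul hne
  have n2 := right_ne_zero_of_mul (left_ne_zero_of_mul hne)
  have n1 := left_ne_zero_of_mul (left_ne_zero_of_mul hne)
  have c1 := coprime_of_resultant (eval u) hPd n1
  have c2 := coprime_of_resultant (eval u) hQd n2
  rw [← Polynomial.derivative_map] at c2
  obtain ⟨Q', hQ', hsep⟩ := expand_sep p e _ c2
  have hPu : (Φ P).map (eval u) = Q' ^ (p ^ e) := by
    rw [← hQ', hPQ, Polynomial.map_expand]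
  have hPud : ((Φ P).map (eval u)).natDegree ≠ 0 := by
    rwa [Polynomial.natDegree_map_of_leadingCoeff_ne_zero _ n3]
  rw [hPu] at c1 hPud
  have heq' : Q' ^ (p ^ e * m) * (Φ S).map (eval u) = Polynomial.C c * h ^ 2 := by
    rw [← heq, pow_mul, ← hPu, ← Polynomial.map_pow, ← Polynomial.map_mul, ← hΦf]
    exact (substX_eq f u).symm
  refine square_contra (Odd.mul hpodd.pow hm) hsep.squarefree ?_ ?_ heq'
  · intro hu
    exact hPud (Polynomial.natDegree_eq_zero_of_isUnit (hu.pow _))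
  · exact (IsCoprime.pow_left_iff (pow_pos hpp.out.pos _)).1 c1

theorem stmt_6 (q k d : ℕ) (F : Type) [Field F] [Fintype F]
    (hF : Fintype.card F = q) (hq : Odd q) (hk : 2 ≤ k)
    (f : MvPolynomial (Fin k) F) (hsym : f.IsSymmetric) (hdeg : f.totalDegree = d)
    (hadm : Admissible f) :
    Set.ncard {u : Fin (k - 1) → F | ∃ (c : F) (h : Polynomial F),
        h.Monic ∧ substX f u = Polynomial.C c * h ^ 2} ≤ (d ^ 2 + d) * q ^ (k - 2) := by
  obtain ⟨n, rfl⟩ := Nat.exists_eq_add_of_le' hk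
  subst hF hdeg
  exact core hq n f hadm
end

section
/- Let k ≥ 2 and d ≥ 1 be fixed integers. There exists a constant C > 0, depending only on k and d, such that the following holds for every odd prime power q and every symmetric polynomial f ∈ F_q[x_1,…,x_k] of total degree d. Let B be the set of tuples (u_2(0), u_2(1), …, u_k(0), u_k(1)) ∈ F_q^{2k−2} such that the univariate polynomial ∏_{(ε_2,…,ε_k) ∈ {0,1}^{k−1}} f(x, u_2(ε_2), u_3(ε_3), …, u_k(ε_k)) is a constant multiple of the square of a polynomial in F_q[x]. Then |N*_{Y_{f,q}}(𝒪_k^e) − q^{2k}/2| ≤ C·(q^{2k−1} + |B|·q²). -/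
section FrozenDefs
open MvPolynomial

/-- The number of labeled induced even partial octahedrons in the hypergraph `Y_{f,q}`. -/
noncomputable def NEPO {F : Type*} [Field F] [Fintype F] {k : ℕ}
    (f : MvPolynomial (Fin k) F) : ℕ :=
  Set.ncard {u : Fin k × Bool → F | Function.Injective u ∧
    Even (Set.ncard {ε : Fin k → Bool |
      ¬ IsSquare (MvPolynomial.eval (fun i => u (i, ε i)) f)})}

/-- The set `B` of tuples `(u_2(0),u_2(1),…,u_k(0),u_k(1))` such that the product
`∏_{ε ∈ {0,1}^{k-1}} f(x, u_2(ε_2),…,u_k(ε_k))` is a constant multiple of the square of a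
polynomial in `F_q[x]`. -/
def badSet {F : Type*} [Field F] {k : ℕ} (f : MvPolynomial (Fin k) F) :
    Set (Fin (k - 1) → Bool → F) :=
  {u | ∃ (c : F) (g : Polynomial F),
    (∏ ε : Fin (k - 1) → Bool, substX f (fun i => u i (ε i))) = Polynomial.C c * g ^ 2}

end FrozenDefs

open Polynomial

section Stepanov
variable {F : Type} [Field F]

lemma hasse_pow (g : F[X]) (m : ℕ) (hg : g.natDegree ≤ m) (c : ℕ) : ∀ i : ℕ,
    ∃ E : F[X], hasseDeriv i (g ^ c) * g ^ i = g ^ c * E ∧ E.natDegree ≤ i * m := by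
  induction c with
  | zero =>
    intro i
    refine ⟨hasseDeriv i 1 * g ^ i, by simp, ?_⟩
    rcases Nat.eq_zero_or_pos i with rfl | hi
    · simp
    · rw [hasseDeriv_apply_one _ hi]; simp
  | succ c ih =>
    intro i
    choose E hE hEd using ih
    refine ⟨∑ ab ∈ Finset.HasAntidiagonal.antidiagonal i, E ab.1 *
      (if ab.2 = 0 then 1 else hasseDeriv ab.2 g * g ^ (ab.2 - 1)), ?_, ?_⟩
    · rw [pow_succ, hasseDeriv_mul, Finset.sum_mul, Finset.mul_sum]
      refine Finset.sum_congr rfl fun ab hab => ?_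
      obtain ⟨a, b⟩ := ab
      simp only [Finset.HasAntidiagonal.mem_antidiagonal] at hab
      subst hab
      simp only
      rcases Nat.eq_zero_or_pos b with rfl | hb
      · simp only [hasseDeriv_zero, LinearMap.id_coe, id_eq, add_zero, if_true]
        linear_combination g * hE a
      · obtain ⟨b, rfl⟩ : ∃ b', b = b' + 1 := ⟨b - 1, by omega⟩
        simp only [Nat.add_eq_zero_iff, one_ne_zero, and_false, if_false, Nat.add_sub_cancel]
        rw [pow_add, pow_succ]
        linear_combination (hasseDeriv (b+1) g * g ^ b * g) * hE a
    · refine natDegree_sum_le_of_forall_le _ _ fun ab hab => ?_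
      obtain ⟨a, b⟩ := ab
      simp only [Finset.HasAntidiagonal.mem_antidiagonal] at hab
      subst hab
      simp only
      refine natDegree_mul_le.trans ?_
      rw [add_mul]
      refine add_le_add (hEd a) ?_
      split_ifs with h
      · simp
      · obtain ⟨b, rfl⟩ : ∃ b', b = b' + 1 := ⟨b - 1, by omega⟩
        refine natDegree_mul_le.trans ?_
        have h1 := natDegree_hasseDeriv_le g (b+1)
        have h2 : (g ^ (b+1-1)).natDegree ≤ b * m := by
          simpa using natDegree_pow_le_of_le b hg
        rw [add_mul, one_mul]
        omega

variable [Fintype F]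

lemma X_sub_C_pow_card (a : F) : (X - C a) ^ Fintype.card F = X ^ Fintype.card F - C a := by
  have h := FiniteField.expand_card (X - C a : F[X])
  rw [← h]; simp

lemma nonvanish (g : F[X]) (m K : ℕ) (hg : g.natDegree ≤ m)
    (hK : 2 * K + m ≤ Fintype.card F) (hK0 : 0 < K)
    (hns : ¬ ∃ (c : F) (t : F[X]), g = C c * t ^ 2) (a : F) (ha : g.eval a ≠ 0) (J : ℕ) :
    ∀ (r s : ℕ → F[X]), (∀ j, r j ∈ degreeLT F K) → (∀ j, s j ∈ degreeLT F K) →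
    g * (∑ j ∈ Finset.range J, r j * ((X - C a) ^ Fintype.card F) ^ j) ^ 2 =
      g ^ Fintype.card F * (∑ j ∈ Finset.range J, s j * ((X - C a) ^ Fintype.card F) ^ j) ^ 2 →
    ∀ j < J, r j = 0 ∧ s j = 0 := by
  have hg0 : g ≠ 0 := by rintro rfl; simp at ha
  induction J with
  | zero => intro r s _ _ _ j hj; omega
  | succ J ih =>
    intro r s hr hs h
    set q := Fintype.card F with hq
    set Y : F[X] := (X - C a) ^ q with hY
    rw [Finset.sum_range_succ', Finset.sum_range_succ'] at h
    simp only [pow_succ _ , ← mul_assoc, ← Finset.sum_mul, pow_zero, mul_one] at h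
    set R' := ∑ j ∈ Finset.range J, r (j+1) * Y ^ j with hR'
    set S' := ∑ j ∈ Finset.range J, s (j+1) * Y ^ j with hS'
    have hYm : Y.Monic := (monic_X_sub_C a).pow q
    have hYd : Y.natDegree = q := by rw [hY, natDegree_pow]; simp
    have hgY : Y ∣ g ^ q - C (g.eval a) := by
      have h1 : g ^ q - C (g.eval a) = (g - C (g.eval a)) ^ q := by
        rw [← FiniteField.expand_card, ← FiniteField.expand_card]; simp
      rw [h1]
      exact pow_dvd_pow_of_dvd (dvd_iff_isRoot.2 (by simp)) q
    obtain ⟨W, hW⟩ := hgY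
    have hdeg : ∀ p ∈ degreeLT F K, p.natDegree + 1 ≤ K := by
      intro p hp
      rw [mem_degreeLT] at hp
      by_cases h0 : p = 0
      · subst h0; simp; omega
      · rw [degree_eq_natDegree h0] at hp
        exact_mod_cast hp
    have key : g * r 0 ^ 2 = C (g.eval a) * s 0 ^ 2 := by
      rw [← sub_eq_zero]
      have hdvd : Y ∣ g * r 0 ^ 2 - C (g.eval a) * s 0 ^ 2 := by
        refine ⟨W * s 0 ^ 2 + g ^ q * (2 * s 0 * S' + S' ^ 2 * Y) - g * (2 * r 0 * R' + R' ^ 2 * Y), ?_⟩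
        linear_combination h + s 0 ^ 2 * hW
      by_contra hne
      have h1 := natDegree_le_of_dvd hdvd hne
      have h2 : (g * r 0 ^ 2 - C (g.eval a) * s 0 ^ 2).natDegree ≤ m + 2 * (K - 1) := by
        have e1 := hdeg _ (hr 0)
        have e2 := hdeg _ (hs 0)
        refine (natDegree_sub_le _ _).trans (max_le ?_ ?_)
        · refine natDegree_mul_le.trans (add_le_add hg (natDegree_pow_le_of_le 2 (by omega)))
        · refine (natDegree_C_mul_le _ _).trans ((natDegree_pow_le_of_le 2 (show _ ≤ K - 1 by omega)).trans (by omega))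
      omega
    have hr0 : r 0 = 0 := by
      by_contra hr0
      have hd : r 0 ^ 2 ∣ s 0 ^ 2 := by
        refine ⟨C (g.eval a)⁻¹ * g, ?_⟩
        have : C (g.eval a)⁻¹ * C (g.eval a) = 1 := by rw [← C_mul, inv_mul_cancel₀ ha, C_1]
        linear_combination (- s 0 ^ 2) * this - C (g.eval a)⁻¹ * key
      rw [UniqueFactorizationMonoid.pow_dvd_pow_iff_dvd (by norm_num)] at hd
      obtain ⟨t, ht⟩ := hd
      refine hns ⟨g.eval a, t, ?_⟩
      have : r 0 ^ 2 ≠ 0 := pow_ne_zero _ hr0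
      apply mul_right_cancel₀ this
      rw [key, ht]; ring
    have hs0 : s 0 = 0 := by
      rw [hr0] at key
      have : C (g.eval a) ≠ 0 := by simpa using ha
      simpa [this] using key.symm
    rw [hr0, hs0] at h
    have h' : g * R' ^ 2 = g ^ q * S' ^ 2 := by
      have : Y ^ 2 ≠ 0 := pow_ne_zero _ hYm.ne_zero
      apply mul_right_cancel₀ this
      linear_combination h
    have := ih (fun j => r (j+1)) (fun j => s (j+1)) (fun j => hr _) (fun j => hs _) h'
    intro j hj
    rcases j with _ | j
    · exact ⟨hr0, hs0⟩
    · exact this j (by omega)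

/-- the auxiliary differential polynomial -/
noncomputable def Qpoly (g : F[X]) (E : ℕ → F[X]) (a α : F) (J l : ℕ) (r s : ℕ → F[X]) : F[X] :=
  ∑ j ∈ Finset.range J, (X - C a) ^ j * (g ^ l * hasseDeriv l (r j) +
    C α * ∑ i ∈ Finset.HasAntidiagonal.antidiagonal l, E i.1 * g ^ i.2 * hasseDeriv i.2 (s j))

lemma Qpoly_eval (g : F[X]) (c : ℕ) (E : ℕ → F[X])
    (hE : ∀ i, hasseDeriv i (g ^ c) * g ^ i = g ^ c * E i) (a α : F) (J l : ℕ) (r s : ℕ → F[X])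
    (x : F) (hx : (g.eval x) ^ c = α) :
    (g.eval x) ^ l * (hasseDeriv l (∑ j ∈ Finset.range J,
      C ((x - a) ^ j) * (r j + s j * g ^ c))).eval x = (Qpoly g E a α J l r s).eval x := by
  rw [Qpoly, map_sum, eval_finsetSum, eval_finsetSum, Finset.mul_sum]
  refine Finset.sum_congr rfl fun j _ => ?_
  rw [← smul_eq_C_mul, map_smul, map_add, mul_comm (s j), hasseDeriv_mul]
  simp only [eval_smul, eval_add, eval_mul, eval_pow, eval_sub, eval_X, eval_C, eval_finsetSum,
    smul_eq_mul, Finset.mul_sum, mul_add]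
  congr 1
  · ring
  · refine Finset.sum_congr rfl fun i hi => ?_
    rw [Finset.HasAntidiagonal.mem_antidiagonal] at hi
    have h := congrArg (eval x) (hE i.1)
    simp only [eval_mul, eval_pow] at h
    rw [hx] at h
    rw [← hi, pow_add]
    linear_combination ((x - a) ^ j * eval x g ^ i.2 * eval x (hasseDeriv i.2 (s j))) * h

lemma Qpoly_degree (g : F[X]) (m : ℕ) (hg : g.natDegree ≤ m) (E : ℕ → F[X])
    (hE : ∀ i, (E i).natDegree ≤ i * m) (a α : F) (J K l M : ℕ) (hl : l < M) (r s : ℕ → F[X])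
    (hr : ∀ j, (r j).natDegree + 1 ≤ K) (hs : ∀ j, (s j).natDegree + 1 ≤ K) (hJ : 0 < J) :
    (Qpoly g E a α J l r s).natDegree < J + K + M * m := by
  have hlm : l * m ≤ M * m := Nat.mul_le_mul_right _ hl.le
  have hK := hr 0
  have : (Qpoly g E a α J l r s).natDegree ≤ (J - 1) + (K - 1 + M * m) := by
    refine natDegree_sum_le_of_forall_le _ _ fun j hj => ?_
    rw [Finset.mem_range] at hj
    refine natDegree_mul_le.trans (add_le_add ?_ ?_)
    · rw [natDegree_pow, natDegree_X_sub_C]; omega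
    · refine natDegree_add_le_of_degree_le ?_ ?_
      · refine natDegree_mul_le.trans ?_
        have h1 := natDegree_pow_le_of_le l hg
        have h2 := natDegree_hasseDeriv_le (r j) l
        have := hr j
        omega
      · refine (natDegree_C_mul_le _ _).trans ?_
        refine natDegree_sum_le_of_forall_le _ _ fun i hi => ?_
        rw [Finset.HasAntidiagonal.mem_antidiagonal] at hi
        refine natDegree_mul_le.trans ?_
        have h0 := natDegree_mul_le (p := E i.1) (q := g ^ i.2)
        have h1 := natDegree_pow_le_of_le i.2 hg
        have h2 := natDegree_hasseDeriv_le (s j) i.2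
        have h3 := hE i.1
        have := hs j
        have h4 : l * m = i.1 * m + i.2 * m := by rw [← hi, add_mul]
        omega
  omega


lemma Qpoly_add (g : F[X]) (E : ℕ → F[X]) (a α : F) (J l : ℕ) (r s r' s' : ℕ → F[X]) :
    Qpoly g E a α J l (r + r') (s + s') = Qpoly g E a α J l r s + Qpoly g E a α J l r' s' := by
  simp only [Qpoly, Pi.add_apply, map_add, mul_add, Finset.sum_add_distrib]
  ring

lemma Qpoly_smul (g : F[X]) (E : ℕ → F[X]) (a α : F) (J l : ℕ) (r s : ℕ → F[X]) (t : F) :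
    Qpoly g E a α J l (t • r) (t • s) = t • Qpoly g E a α J l r s := by
  simp only [Qpoly, Pi.smul_apply, map_smul, mul_smul_comm, ← Finset.smul_sum, ← smul_add]

/-- extension by zero -/
noncomputable def extz {J K : ℕ} : (Fin J → degreeLT F K) →ₗ[F] (ℕ → F[X]) where
  toFun v := fun j => if h : j < J then (v ⟨j, h⟩ : F[X]) else 0
  map_add' v w := by
    funext j
    by_cases h : j < J <;> simp [h]
  map_smul' t v := by
    funext j
    by_cases h : j < J <;> simp [h]

lemma extz_mem {J K : ℕ} (v : Fin J → degreeLT F K) (j : ℕ) : extz v j ∈ degreeLT F K := by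
  by_cases h : j < J
  · simp [extz, h]
  · simp [extz, h]

/-- the linear system -/
noncomputable def PhiMap (g : F[X]) (E : ℕ → F[X]) (a α : F) (J K M L : ℕ) :
    ((Fin J → degreeLT F K) × (Fin J → degreeLT F K)) →ₗ[F] (Fin M × Fin L → F) where
  toFun v := fun ln => (Qpoly g E a α J ln.1 (extz v.1) (extz v.2)).coeff ln.2
  map_add' v w := by
    funext ln
    simp [Qpoly_add]
  map_smul' t v := by
    funext ln
    simp [Qpoly_smul]

lemma exists_rs (g : F[X]) (E : ℕ → F[X]) (a α : F) (J K M L : ℕ)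
    (hdim : M * L < 2 * J * K) :
    ∃ v : (Fin J → degreeLT F K) × (Fin J → degreeLT F K), v ≠ 0 ∧
      PhiMap g E a α J K M L v = 0 := by
  have hfd : Module.Finite F (degreeLT F K) := Module.Finite.equiv (degreeLTEquiv F K).symm
  have hfr : Module.finrank F (degreeLT F K) = K := by
    rw [(degreeLTEquiv F K).finrank_eq]; simp
  have hk : LinearMap.ker (PhiMap g E a α J K M L) ≠ ⊥ := by
    apply LinearMap.ker_ne_bot_of_finrank_lt
    have h1 : Module.finrank F (Fin J → degreeLT F K) = J * K := by
      rw [Module.finrank_pi_fintype]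
      simp only [hfr, Fintype.card_fin, Finset.sum_const, Finset.card_univ, smul_eq_mul]
    have h2 : Module.finrank F (Fin M × Fin L → F) = M * L := by
      rw [Module.finrank_fintype_fun_eq_card]; simp
    rw [Module.finrank_prod, h1, h2]
    linarith
  obtain ⟨v, hv, hv0⟩ := Submodule.exists_mem_ne_zero_of_ne_bot hk
  exact ⟨v, hv0, hv⟩

lemma stepanov (g : F[X]) (m J K M c : ℕ) (hg : g.natDegree ≤ m)
    (hK : 2 * K + m ≤ Fintype.card F) (hK0 : 0 < K) (hJ : 0 < J) (hMq : M ≤ Fintype.card F)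
    (hc : 2 * c + 1 = Fintype.card F) (hc0 : 0 < c)
    (hns : ¬ ∃ (c : F) (t : F[X]), g = C c * t ^ 2) (a : F) (ha : g.eval a ≠ 0)
    (hdim : M * (J + K + M * m) < 2 * J * K) (α : F) (hα : α ≠ 0) (A : Finset F)
    (hA : ∀ x ∈ A, (g.eval x) ^ c = α) :
    M * A.card ≤ K + c * m + Fintype.card F * J := by
  choose E hE hEd using hasse_pow g m hg c
  obtain ⟨⟨v, w⟩, hv0, hv⟩ := exists_rs g E a α J K M (J + K + M * m) hdim
  set r := extz v with hr
  set s := extz w with hs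
  set q := Fintype.card F with hq
  have hdeg : ∀ p ∈ degreeLT F K, p.natDegree + 1 ≤ K := by
    intro p hp
    rw [mem_degreeLT] at hp
    by_cases h0 : p = 0
    · subst h0; simp; omega
    · rw [degree_eq_natDegree h0] at hp
      exact_mod_cast hp
  have hrd : ∀ j, (r j).natDegree + 1 ≤ K := fun j => hdeg _ (extz_mem v j)
  have hsd : ∀ j, (s j).natDegree + 1 ≤ K := fun j => hdeg _ (extz_mem w j)
  have hQ : ∀ l < M, Qpoly g E a α J l r s = 0 := by
    intro l hl
    ext n
    have hd := Qpoly_degree g m hg E hEd a α J K l M hl r s hrd hsd hJ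
    by_cases hn : n < J + K + M * m
    · exact congrFun hv (⟨l, hl⟩, ⟨n, hn⟩)
    · rw [coeff_eq_zero_of_natDegree_lt (by omega)]; simp
  set Y : F[X] := (X - C a) ^ q with hY
  set P : F[X] := ∑ j ∈ Finset.range J, Y ^ j * (r j + s j * g ^ c) with hP
  have hYd : Y.natDegree = q := by rw [hY, natDegree_pow]; simp
  have hPd : P.natDegree ≤ K + c * m + q * J := by
    refine natDegree_sum_le_of_forall_le _ _ fun j hj => ?_
    rw [Finset.mem_range] at hj
    refine natDegree_mul_le.trans ?_
    rw [natDegree_pow, hYd, add_comm]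
    refine add_le_add ?_ ?_
    · refine natDegree_add_le_of_degree_le ?_ ?_
      · have := hrd j; omega
      · refine natDegree_mul_le.trans (add_le_add ?_ (natDegree_pow_le_of_le c hg))
        have := hsd j; omega
    · rw [mul_comm]; exact Nat.mul_le_mul_left _ hj.le
  have hP0 : P ≠ 0 := by
    intro h0
    have hsplit : P = ∑ j ∈ Finset.range J, r j * Y ^ j
        + (∑ j ∈ Finset.range J, s j * Y ^ j) * g ^ c := by
      rw [hP, Finset.sum_mul, ← Finset.sum_add_distrib]
      exact Finset.sum_congr rfl fun j _ => by ring
    rw [h0] at hsplit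
    have := nonvanish g m K hg hK hK0 hns a ha J r s (extz_mem v) (extz_mem w) (by
      rw [← hq, ← hY, eq_neg_of_add_eq_zero_left hsplit.symm]
      have : g ^ q = g * (g ^ c) ^ 2 := by rw [← hc]; ring
      rw [this]
      ring)
    apply hv0
    ext j
    · have h1 := (this j j.2).1
      simp only [hr, extz, LinearMap.coe_mk, AddHom.coe_mk, j.2, dif_pos] at h1
      simp [h1]
    · have h1 := (this j j.2).2
      simp only [hs, extz, LinearMap.coe_mk, AddHom.coe_mk, j.2, dif_pos] at h1
      simp [h1]
  have hdvd : ∀ x ∈ A, (X - C x) ^ M ∣ P := by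
    intro x hx
    have hgx : g.eval x ≠ 0 := by
      intro h0
      have := hA x hx
      rw [h0, zero_pow (by omega)] at this
      exact hα this.symm
    have hYx : Y - C (x - a) = (X - C x) ^ q := by
      rw [hY, X_sub_C_pow_card, X_sub_C_pow_card, C_sub]; ring
    have h1 : (X - C x) ^ M ∣ P - ∑ j ∈ Finset.range J, C ((x - a) ^ j) * (r j + s j * g ^ c) := by
      rw [hP, ← Finset.sum_sub_distrib]
      refine Finset.dvd_sum fun j _ => ?_
      rw [← sub_mul, C_pow]
      refine Dvd.dvd.mul_right ?_ _
      refine (pow_dvd_pow _ hMq).trans ?_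
      rw [← hYx]
      exact sub_dvd_pow_sub_pow _ _ _
    have h2 : (X - C x) ^ M ∣ ∑ j ∈ Finset.range J, C ((x - a) ^ j) * (r j + s j * g ^ c) := by
      rw [X_sub_C_pow_dvd_iff, X_pow_dvd_iff]
      intro l hl
      rw [← taylor_apply, taylor_coeff]
      have h3 := Qpoly_eval g c E hE a α J l r s x (hA x hx)
      rw [hQ l hl, eval_zero] at h3
      exact (mul_eq_zero.1 h3).resolve_left (pow_ne_zero _ hgx)
    have := dvd_add h1 h2
    rwa [sub_add_cancel] at this
  have hprod : ∏ x ∈ A, (X - C x) ^ M ∣ P := by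
    refine Finset.prod_dvd_of_coprime ?_ hdvd
    intro x _ y _ hxy
    exact (isCoprime_X_sub_C_of_isUnit_sub (sub_ne_zero.2 hxy).isUnit).pow
  have hfin := natDegree_le_of_dvd hprod hP0
  rw [natDegree_prod_of_monic _ _ (fun x _ => (monic_X_sub_C x).pow M)] at hfin
  simp only [natDegree_pow, natDegree_X_sub_C, mul_one, Finset.sum_const, smul_eq_mul] at hfin
  rw [mul_comm]
  exact hfin.trans hPd


lemma stepanov_num (q m M K : ℕ) (hq : 4 * m + 16 ≤ q) (hM : M * M ≤ q)
    (hM4 : 4 * M ≤ q) (hK : q ≤ 2 * K + m + 1) (J : ℕ) (hJ : J = (M + 1) / 2 + 2 * m + 3) :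
    M * (J + K + M * m) < 2 * J * K := by
  have h1 : M + 4 * m + 6 ≤ 2 * J := by omega
  have h2 : 2 * J ≤ M + 4 * m + 7 := by omega
  have a1 : (M + 4 * m + 6) * K ≤ 2 * J * K := Nat.mul_le_mul_right _ h1
  have a2 : M * (2 * J) ≤ M * (M + 4 * m + 7) := Nat.mul_le_mul_left _ h2
  have a3 : (2 * m + 3) * q ≤ (2 * m + 3) * (2 * K + m + 1) := Nat.mul_le_mul_left _ hK
  have a4 : (M * M) * m ≤ q * m := Nat.mul_le_mul_right _ hM
  have a5 : (4 * M) * (4 * m + 7) ≤ q * (4 * m + 7) := Nat.mul_le_mul_right _ hM4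
  have a6 : (4 * m + 16) * (m + 1) ≤ q * (m + 1) := Nat.mul_le_mul_right _ hq
  nlinarith

lemma stepanov_bound (g : F[X]) (m c : ℕ) (hg : g.natDegree ≤ m)
    (hq : 4 * m + 16 ≤ Fintype.card F)
    (hc : 2 * c + 1 = Fintype.card F)
    (hns : ¬ ∃ (c : F) (t : F[X]), g = C c * t ^ 2)
    (α : F) (hα : α ≠ 0) (A : Finset F)
    (hA : ∀ x ∈ A, (g.eval x) ^ c = α) :
    (A.card : ℝ) ≤ (Fintype.card F : ℝ) / 2 + (10 * m + 20) * √(Fintype.card F : ℝ) := by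
  classical
  have hg0 : g ≠ 0 := by rintro rfl; exact hns ⟨0, 0, by simp⟩
  obtain ⟨a, ha⟩ : ∃ a, g.eval a ≠ 0 := by
    by_contra! hall
    have h1 := Polynomial.card_roots' g
    have h2 : (Finset.univ : Finset F).card ≤ g.roots.card := by
      refine (Finset.card_le_card ?_).trans (Multiset.toFinset_card_le g.roots)
      intro x _
      simp [hg0, hall x]
    rw [Finset.card_univ] at h2
    omega
  set q := Fintype.card F with hqdef
  set M := Nat.sqrt q with hM
  have hMM : M * M ≤ q := Nat.sqrt_le q
  have hMM' : q < (M + 1) * (M + 1) := Nat.lt_succ_sqrt q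
  have hM4' : 4 ≤ M := by
    by_contra hlt
    have : M + 1 ≤ 4 := by omega
    have : (M + 1) * (M + 1) ≤ 4 * 4 := Nat.mul_le_mul this this
    omega
  have hM4 : 4 * M ≤ q := (Nat.mul_le_mul_right M hM4').trans hMM
  set K := (q - m) / 2 with hK
  set J := (M + 1) / 2 + 2 * m + 3 with hJ
  have hdim := stepanov_num q m M K hq hMM hM4 (by omega) J hJ
  have main := stepanov g m J K M c hg (by omega) (by omega) (by omega) (by omega) hc (by omega)
    hns a ha hdim α hα A hA
  rw [← hqdef] at main
  have e1 : 2 * K ≤ q := by omega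
  have e2 : 2 * c ≤ q := by omega
  have e3 : 2 * J ≤ M + 4 * m + 7 := by omega
  have e4 : 2 * (M * A.card) ≤ q + q * m + q * (M + 4 * m + 7) := by
    have f1 := Nat.mul_le_mul_right m e2
    have f2 := Nat.mul_le_mul_left q e3
    nlinarith
  have e5 : q ≤ 4 * (M * M) := by nlinarith
  have hMpos : (0 : ℝ) < M := by exact_mod_cast (by omega : 0 < M)
  have e4' : 2 * ((M : ℝ) * A.card) ≤ q + q * m + q * (M + 4 * m + 7) := by exact_mod_cast e4
  have e5' : (q : ℝ) ≤ 4 * (M * M) := by exact_mod_cast e5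
  have hsq : (M : ℝ) ≤ √(q : ℝ) := by
    apply Real.le_sqrt_of_sq_le
    rw [sq]; exact_mod_cast hMM
  have e6 : (A.card : ℝ) ≤ q / 2 + (10 * m + 20) * M := by
    have : (M : ℝ) * A.card ≤ M * (q / 2 + (10 * m + 20) * M) := by
      have hm : (0 : ℝ) ≤ m := Nat.cast_nonneg m
      nlinarith [mul_le_mul_of_nonneg_right e5' (by positivity : (0:ℝ) ≤ 5 * m + 8)]
    exact le_of_mul_le_mul_left this hMpos
  refine e6.trans ?_
  have : (0:ℝ) ≤ 10 * m + 20 := by positivity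
  nlinarith

/-- sign of a residue: `1` on squares (including zero), `-1` otherwise -/
noncomputable def sgnSq (a : F) : ℝ := by
  classical exact if IsSquare a then 1 else -1

lemma sgnSq_abs (a : F) : |sgnSq a| = 1 := by
  unfold sgnSq; split_ifs <;> simp

lemma card_zeros_le (g : F[X]) (m : ℕ) (hg : g.natDegree ≤ m) (hg0 : g ≠ 0) (A : Finset F)
    (hA : ∀ x ∈ A, g.eval x = 0) : A.card ≤ m := by
  classical
  have h1 := Polynomial.card_roots' g
  have h2 : A.card ≤ g.roots.card := by
    refine (Finset.card_le_card ?_).trans (Multiset.toFinset_card_le g.roots)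
    intro x hx
    simp [hg0, hA x hx]
  omega

lemma weil_large (g : F[X]) (m : ℕ) (hg : g.natDegree ≤ m)
    (hq : 4 * m + 16 ≤ Fintype.card F) (hodd : Odd (Fintype.card F))
    (hns : ¬ ∃ (c : F) (t : F[X]), g = C c * t ^ 2) :
    |∑ x : F, sgnSq (g.eval x)| ≤ (20 * m + 40) * √(Fintype.card F : ℝ) + 2 * m := by
  classical
  have hg0 : g ≠ 0 := by rintro rfl; exact hns ⟨0, 0, by simp⟩
  have hchar : ringChar F ≠ 2 := by
    intro h
    have := FiniteField.even_card_of_char_two h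
    rw [Nat.odd_iff] at hodd; omega
  obtain ⟨c, hc⟩ := hodd
  have hc2 : Fintype.card F / 2 = c := by omega
  set Z := Finset.univ.filter fun x : F => g.eval x = 0 with hZ
  set P := Finset.univ.filter fun x : F => (g.eval x) ^ c = 1 with hP
  set N := Finset.univ.filter fun x : F => (g.eval x) ^ c = -1 with hN
  have hZc : Z.card ≤ m := card_zeros_le g m hg hg0 Z (by simp [hZ])
  have hPc := stepanov_bound g m c hg hq hc.symm hns 1 one_ne_zero P (by simp [hP])
  have hNc := stepanov_bound g m c hg hq hc.symm hns (-1) (by simp) N (by simp [hN])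
  have hneg : (-1 : F) ≠ 1 := Ring.neg_one_ne_one_of_char_ne_two hchar
  have hc0 : c ≠ 0 := by omega
  have hpt : ∀ x : F, sgnSq (g.eval x) = (if g.eval x = 0 then (1:ℝ) else 0) +
      (if (g.eval x) ^ c = 1 then 1 else 0) - (if (g.eval x) ^ c = -1 then 1 else 0) ∧
      (1 : ℝ) = (if g.eval x = 0 then (1:ℝ) else 0) +
      (if (g.eval x) ^ c = 1 then 1 else 0) + (if (g.eval x) ^ c = -1 then 1 else 0) := by
    intro x
    by_cases h0 : g.eval x = 0
    · have e1 : (0:F) ^ c ≠ 1 := by rw [zero_pow hc0]; exact zero_ne_one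
      have e2 : (0:F) ^ c ≠ -1 := by rw [zero_pow hc0]; exact (neg_ne_zero.2 one_ne_zero).symm
      rw [h0, if_pos rfl, if_neg e1, if_neg e2]; simp [sgnSq]
    · have h1 := FiniteField.isSquare_iff hchar h0
      have h2 := FiniteField.pow_dichotomy hchar h0
      rw [hc2] at h1 h2
      unfold sgnSq
      rcases h2 with h2 | h2
      · rw [if_pos (h1.2 h2), if_neg h0, if_pos h2, if_neg (by rw [h2]; exact hneg.symm)]; norm_num
      · rw [if_neg (fun h => hneg (h2.symm.trans (h1.1 h))), if_neg h0, if_pos h2, if_neg (by rw [h2]; exact hneg)]; norm_num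
  have hsum : ∑ x : F, sgnSq (g.eval x) = Z.card + P.card - N.card := by
    rw [Finset.sum_congr rfl fun x _ => (hpt x).1]
    simp [Finset.sum_add_distrib, Finset.sum_sub_distrib, hZ, hP, hN]
  have hone : (Fintype.card F : ℝ) = Z.card + P.card + N.card := by
    have : (Fintype.card F : ℝ) = ∑ x : F, (1 : ℝ) := by simp
    rw [this, Finset.sum_congr rfl fun x _ => (hpt x).2]
    simp only [Finset.sum_add_distrib, hZ, hP, hN, Finset.sum_boole]
  have hZc' : (Z.card : ℝ) ≤ m := by exact_mod_cast hZc
  have hZ0 : (0 : ℝ) ≤ Z.card := Nat.cast_nonneg _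
  have hm0 : (0 : ℝ) ≤ m := by positivity
  rw [hsum, abs_le]
  constructor <;> linarith

lemma weil (g : F[X]) (m : ℕ) (hg : g.natDegree ≤ m) (hodd : Odd (Fintype.card F))
    (hns : ¬ ∃ (c : F) (t : F[X]), g = C c * t ^ 2) :
    |∑ x : F, sgnSq (g.eval x)| ≤ (22 * m + 40) * √(Fintype.card F : ℝ) := by
  have hm0 : (0 : ℝ) ≤ m := by positivity
  have h1 : (1 : ℝ) ≤ Fintype.card F := by exact_mod_cast Fintype.card_pos
  have h1' : (1 : ℝ) ≤ √(Fintype.card F : ℝ) := Real.one_le_sqrt.2 h1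
  by_cases hq : 4 * m + 16 ≤ Fintype.card F
  · have := weil_large g m hg hq hodd hns
    nlinarith
  · have h2 : |∑ x : F, sgnSq (g.eval x)| ≤ Fintype.card F := by
      refine (Finset.abs_sum_le_sum_abs _ _).trans ?_
      simp [sgnSq_abs]
    have h3 : (Fintype.card F : ℝ) ≤ 4 * m + 16 := by exact_mod_cast (by omega : Fintype.card F ≤ 4 * m + 16)
    nlinarith

lemma sgnSq_mul (hodd : Odd (Fintype.card F)) {a b : F} (ha : a ≠ 0) (hb : b ≠ 0) :
    sgnSq (a * b) = sgnSq a * sgnSq b := by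
  classical
  have hchar : ringChar F ≠ 2 := by
    intro h
    have := FiniteField.even_card_of_char_two h
    rw [Nat.odd_iff] at hodd; omega
  have key : ∀ x : F, x ≠ 0 → sgnSq x = ((quadraticChar F x : ℤ) : ℝ) := by
    intro x hx
    unfold sgnSq
    by_cases h : IsSquare x
    · rw [(quadraticChar_one_iff_isSquare hx).2 h]; simp [h]
    · rw [quadraticChar_neg_one_iff_not_isSquare.2 h]; simp [h]
  rw [key _ ha, key _ hb, key _ (mul_ne_zero ha hb), map_mul]
  push_cast; rfl

lemma sgnSq_prod (hodd : Odd (Fintype.card F)) {ι : Type*} (s : Finset ι) (a : ι → F)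
    (ha : ∀ i ∈ s, a i ≠ 0) : sgnSq (∏ i ∈ s, a i) = ∏ i ∈ s, sgnSq (a i) := by
  classical
  induction s using Finset.induction_on with
  | empty => simp [sgnSq]
  | insert i s hi ih =>
    rw [Finset.prod_insert hi, Finset.prod_insert hi, sgnSq_mul hodd (ha i (by simp))
      (Finset.prod_ne_zero_iff.2 fun j hj => ha j (by simp [hj])), ih fun j hj => ha j (by simp [hj])]

lemma weil_prod {ι : Type*} [Fintype ι] (G : ι → F[X]) (m : ℕ)
    (hg : (∏ i, G i).natDegree ≤ m) (hodd : Odd (Fintype.card F))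
    (hns : ¬ ∃ (c : F) (t : F[X]), ∏ i, G i = C c * t ^ 2) :
    |∑ x : F, ∏ i, sgnSq ((G i).eval x)| ≤ (24 * m + 40) * √(Fintype.card F : ℝ) := by
  classical
  have hg0 : (∏ i, G i) ≠ 0 := by intro h; exact hns ⟨0, 0, by simp [h]⟩
  have h0 := weil _ m hg hodd hns
  have hm0 : (0 : ℝ) ≤ m := by positivity
  have h1 : (1 : ℝ) ≤ Fintype.card F := by exact_mod_cast Fintype.card_pos
  have h1' : (1 : ℝ) ≤ √(Fintype.card F : ℝ) := Real.one_le_sqrt.2 h1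
  set Z := Finset.univ.filter fun x : F => (∏ i, G i).eval x = 0 with hZ
  have hZc : Z.card ≤ m := card_zeros_le _ m hg hg0 Z (by simp [hZ])
  have hZc' : (Z.card : ℝ) ≤ m := by exact_mod_cast hZc
  have hd : |∑ x : F, ∏ i, sgnSq ((G i).eval x) - ∑ x : F, sgnSq ((∏ i, G i).eval x)| ≤ 2 * m := by
    rw [← Finset.sum_sub_distrib]
    refine (Finset.abs_sum_le_sum_abs _ _).trans ?_
    calc _ ≤ ∑ x : F, (if (∏ i, G i).eval x = 0 then (2:ℝ) else 0) := by
          refine Finset.sum_le_sum fun x _ => ?_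
          split_ifs with h
          · refine (abs_sub _ _).trans ?_
            rw [Finset.abs_prod]
            simp only [sgnSq_abs, Finset.prod_const_one]
            norm_num
          · rw [eval_prod] at h ⊢
            rw [sgnSq_prod hodd _ _ (Finset.prod_ne_zero_iff.1 h)]
            simp
      _ = Z.card * 2 := by
          rw [← Finset.sum_filter, Finset.sum_const, nsmul_eq_mul]
      _ ≤ 2 * m := by linarith
  have := abs_sub_abs_le_abs_sub (∑ x : F, ∏ i, sgnSq ((G i).eval x)) (∑ x : F, sgnSq ((∏ i, G i).eval x))
  nlinarith

lemma eval_substX {n : ℕ} (f : MvPolynomial (Fin (n + 1)) F) (u : Fin n → F) (x : F) :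
    (substX f u).eval x = MvPolynomial.eval (Fin.cons x u : Fin (n + 1) → F) f := by
  unfold substX
  rw [← Polynomial.coe_evalRingHom, MvPolynomial.aeval_def, MvPolynomial.hom_eval₂]
  rw [MvPolynomial.eval, MvPolynomial.coe_eval₂Hom]
  congr 1
  · ext a; simp
  · funext i
    refine Fin.cases ?_ (fun j => ?_) i
    · simp
    · simp

lemma natDegree_substX {k : ℕ} (f : MvPolynomial (Fin k) F) (u : Fin (k - 1) → F) :
    (substX f u).natDegree ≤ f.totalDegree := by
  unfold substX
  have := MvPolynomial.aeval_natDegree_le f (le_refl f.totalDegree) (fun i : Fin k =>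
    if h : (i : ℕ) = 0 then (Polynomial.X : Polynomial F)
    else Polynomial.C (u ⟨(i : ℕ) - 1, by have := i.isLt; omega⟩)) (n := 1) (by
      intro i; split_ifs <;> simp)
  simpa using this

lemma card_noninj (ι : Type) [Fintype ι] [DecidableEq ι] [DecidableEq F] :
    (Finset.univ.filter fun u : ι → F => ¬ Function.Injective u).card ≤
      (Fintype.card ι) ^ 2 * Fintype.card F ^ (Fintype.card ι - 1) := by
  have hsub : (Finset.univ.filter fun u : ι → F => ¬ Function.Injective u) ⊆
      (Finset.univ : Finset (ι × ι)).biUnion fun ab =>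
        Finset.univ.filter fun u : ι → F => ab.1 ≠ ab.2 ∧ u ab.1 = u ab.2 := by
    intro u hu
    have hu := (Finset.mem_filter.1 hu).2
    unfold Function.Injective at hu
    push Not at hu
    obtain ⟨a, b, h1, h2⟩ := hu
    simp only [Finset.mem_biUnion, Finset.mem_filter, Finset.mem_univ, true_and]
    exact ⟨(a, b), h2, h1⟩
  refine (Finset.card_le_card hsub).trans ((Finset.card_biUnion_le_card_mul _ _
    (Fintype.card F ^ (Fintype.card ι - 1)) ?_).trans ?_)
  · rintro ⟨a, b⟩ _
    have : Fintype.card ({c : ι // c ≠ a} → F) = Fintype.card F ^ (Fintype.card ι - 1) := by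
      rw [Fintype.card_fun, Fintype.card_subtype_compl]; simp
    rw [← this, ← Finset.card_univ]
    refine Finset.card_le_card_of_injOn (fun u c => u c.1) (fun _ _ => Finset.mem_coe.2 (Finset.mem_univ _)) ?_
    intro u hu v hv huv
    simp only [Finset.coe_filter, Finset.mem_univ, true_and, Set.mem_setOf_eq] at hu hv
    funext c
    by_cases hc : c = a
    · subst hc
      rw [hu.2, hv.2]
      exact congrFun huv ⟨b, Ne.symm hu.1⟩
    · exact congrFun huv ⟨c, hc⟩
  · simp [sq]

lemma sgn_even {ι : Type} [Fintype ι] (a : ι → F) [Decidable (Even (Set.ncard {i | ¬ IsSquare (a i)}))] :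
    (if Even (Set.ncard {i | ¬ IsSquare (a i)}) then (1 : ℝ) else 0) = (1 + ∏ i, sgnSq (a i)) / 2 := by
  classical
  have h1 : ∏ i, sgnSq (a i) = (-1 : ℝ) ^ Set.ncard {i | ¬ IsSquare (a i)} := by
    rw [Set.ncard_eq_toFinset_card', Set.toFinset_setOf]
    rw [← Finset.prod_const, Finset.prod_filter]
    refine Finset.prod_congr rfl fun i _ => ?_
    unfold sgnSq
    by_cases h : IsSquare (a i) <;> simp [h]
  rw [h1]
  split_ifs with h
  · rw [h.neg_one_pow]; norm_num
  · rw [(Nat.not_even_iff_odd.1 h).neg_one_pow]; norm_num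

lemma NEPO_approx {k : ℕ} (f : MvPolynomial (Fin k) F) :
    |(NEPO f : ℝ) - (Fintype.card F : ℝ) ^ (2 * k) / 2| ≤
      (2 * k) ^ 2 * (Fintype.card F : ℝ) ^ (2 * k - 1) +
      |∑ u : Fin k × Bool → F, ∏ ε : Fin k → Bool,
        sgnSq (MvPolynomial.eval (fun i => u (i, ε i)) f)| := by
  classical
  set T := ∑ u : Fin k × Bool → F, ∏ ε : Fin k → Bool,
        sgnSq (MvPolynomial.eval (fun i => u (i, ε i)) f) with hT
  set p : (Fin k × Bool → F) → Prop := fun u => Even (Set.ncard {ε : Fin k → Bool |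
      ¬ IsSquare (MvPolynomial.eval (fun i => u (i, ε i)) f)}) with hp
  have hN : NEPO f = (Finset.univ.filter fun u => Function.Injective u ∧ p u).card := by
    unfold NEPO
    rw [Set.ncard_eq_toFinset_card', Set.toFinset_setOf]
  have hE : ((Finset.univ.filter p).card : ℝ) = (Fintype.card F : ℝ) ^ (2 * k) / 2 + T / 2 := by
    rw [← Finset.sum_boole]
    rw [Finset.sum_congr rfl fun u _ => sgn_even _]
    rw [← Finset.sum_div, Finset.sum_add_distrib, ← hT]
    simp [mul_comm k 2, add_div]
  have h1 : (Finset.univ.filter fun u => Function.Injective u ∧ p u).card ≤ (Finset.univ.filter p).card :=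
    Finset.card_le_card (fun u hu => by simp at hu ⊢; exact hu.2)
  have h2 : (Finset.univ.filter p).card ≤ (Finset.univ.filter fun u => Function.Injective u ∧ p u).card
      + (Finset.univ.filter fun u : Fin k × Bool → F => ¬ Function.Injective u).card := by
    rw [← Finset.card_filter_add_card_filter_not (s := Finset.univ.filter p) (p := Function.Injective)]
    refine add_le_add (Finset.card_le_card ?_) (Finset.card_le_card ?_)
    · intro u hu; simp at hu ⊢; exact hu.symm
    · intro u hu; simp at hu ⊢; exact hu.2
  have h3 := card_noninj (F := F) (Fin k × Bool)
  have h4 : Fintype.card (Fin k × Bool) = 2 * k := by simp [mul_comm]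
  rw [h4] at h3
  rw [← hN] at h1 h2
  have h1' : (NEPO f : ℝ) ≤ (Finset.univ.filter p).card := by exact_mod_cast h1
  have h2' : ((Finset.univ.filter p).card : ℝ) ≤ NEPO f + (2 * k) ^ 2 * (Fintype.card F : ℝ) ^ (2 * k - 1) := by
    exact_mod_cast h2.trans (Nat.add_le_add_left h3 _)
  have h5 := neg_abs_le T
  have h6 := le_abs_self T
  have h7 := abs_nonneg T
  have h8 : (0 : ℝ) ≤ (2 * k) ^ 2 * (Fintype.card F : ℝ) ^ (2 * k - 1) := by positivity
  rw [abs_le]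
  constructor <;> linarith

lemma T_eq {n : ℕ} (f : MvPolynomial (Fin (n + 1)) F) :
    ∑ u : Fin (n + 1) × Bool → F, ∏ ε : Fin (n + 1) → Bool,
        sgnSq (MvPolynomial.eval (fun i => u (i, ε i)) f) =
    ∑ w : Fin n → Bool → F, (∑ x : F, ∏ ε : Fin n → Bool,
      sgnSq ((substX f (fun i => w i (ε i))).eval x)) ^ 2 := by
  classical
  rw [← (Equiv.curry (Fin (n + 1)) Bool F).symm.sum_comp]
  rw [← (Fin.consEquiv (fun _ : Fin (n + 1) => Bool → F)).sum_comp]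
  rw [Fintype.sum_prod_type_right]
  refine Finset.sum_congr rfl fun w _ => ?_
  rw [← (Equiv.boolArrowEquivProd F).symm.sum_comp, Fintype.sum_prod_type, sq, Finset.sum_mul_sum]
  refine Finset.sum_congr rfl fun x _ => Finset.sum_congr rfl fun y _ => ?_
  rw [← (Fin.consEquiv (fun _ : Fin (n + 1) => Bool)).prod_comp, Fintype.prod_prod_type]
  rw [Fintype.prod_bool, mul_comm]
  congr 1 <;>
  · refine Finset.prod_congr rfl fun ε _ => ?_
    rw [eval_substX]
    congr 3
    funext i
    refine Fin.cases ?_ (fun j => ?_) i <;> simp [Fin.consEquiv, Equiv.boolArrowEquivProd]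

lemma T_bound {n : ℕ} (f : MvPolynomial (Fin (n + 1)) F) (hodd : Odd (Fintype.card F)) :
    |∑ u : Fin (n + 1) × Bool → F, ∏ ε : Fin (n + 1) → Bool,
        sgnSq (MvPolynomial.eval (fun i => u (i, ε i)) f)| ≤
    (24 * (2 ^ n * f.totalDegree : ℕ) + 40) ^ 2 * (Fintype.card F : ℝ) ^ (2 * n + 1) +
      (Set.ncard (badSet f) : ℝ) * (Fintype.card F : ℝ) ^ 2 := by
  classical
  set m := 2 ^ n * f.totalDegree with hm
  set q := Fintype.card F with hq
  rw [T_eq, abs_of_nonneg (Finset.sum_nonneg fun _ _ => sq_nonneg _)]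
  have hpt : ∀ w : Fin n → Bool → F, (∑ x : F, ∏ ε : Fin n → Bool,
      sgnSq ((substX f (fun i => w i (ε i))).eval x)) ^ 2 ≤ (24 * (m : ℝ) + 40) ^ 2 * q +
        if w ∈ badSet f then (q : ℝ) ^ 2 else 0 := by
    intro w
    rw [← sq_abs]
    split_ifs with hw
    · have : |∑ x : F, ∏ ε : Fin n → Bool, sgnSq ((substX f (fun i => w i (ε i))).eval x)| ≤ q := by
        refine (Finset.abs_sum_le_sum_abs _ _).trans ?_
        simp [Finset.abs_prod, sgnSq_abs, hq]
      have h2 := pow_le_pow_left₀ (abs_nonneg _) this 2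
      have h3 : (0 : ℝ) ≤ (24 * (m : ℝ) + 40) ^ 2 * q := by positivity
      linarith
    · have hd : (∏ ε : Fin n → Bool, substX f (fun i => w i (ε i))).natDegree ≤ m := by
        refine (natDegree_prod_le _ _).trans ?_
        refine (Finset.sum_le_card_nsmul _ _ f.totalDegree fun ε _ => natDegree_substX f _).trans ?_
        simp [hm]
      have h1 := weil_prod (fun ε : Fin n → Bool => substX f (fun i => w i (ε i))) m hd hodd hw
      have h2 := pow_le_pow_left₀ (abs_nonneg _) h1 2
      rw [mul_pow, Real.sq_sqrt (Nat.cast_nonneg _)] at h2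
      simpa using h2
  refine (Finset.sum_le_sum fun w _ => hpt w).trans ?_
  rw [Finset.sum_add_distrib, Finset.sum_const, Finset.card_univ, ← Finset.sum_filter, Finset.sum_const]
  have hB : (Finset.univ.filter fun w => w ∈ badSet f).card = Set.ncard (badSet f) := by
    rw [Set.ncard_eq_toFinset_card']
    congr 1; ext; simp
  have hc : Fintype.card (Fin n → Bool → F) = q ^ (2 * n) := by
    simp [hq, ← pow_mul]
  rw [nsmul_eq_mul, nsmul_eq_mul]
  erw [hB, hc]
  push_cast
  apply le_of_eq
  ring

end Stepanov

open MvPolynomial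

theorem stmt_8 (k d : ℕ) (hk : 2 ≤ k) (hd : 1 ≤ d) :
    ∃ C : ℝ, 0 < C ∧
      ∀ (q : ℕ) (F : Type) [Field F] [Fintype F],
        Fintype.card F = q → Odd q →
        ∀ f : MvPolynomial (Fin k) F, f.IsSymmetric → f.totalDegree = d →
          |(NEPO f : ℝ) - (q : ℝ) ^ (2 * k) / 2| ≤
            C * ((q : ℝ) ^ (2 * k - 1) + (Set.ncard (badSet f) : ℝ) * (q : ℝ) ^ 2) := by
  obtain ⟨n, rfl⟩ : ∃ n, k = n + 1 := ⟨k - 1, by omega⟩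
  refine ⟨(2 * (n + 1)) ^ 2 + (24 * (2 ^ n * d : ℕ) + 40) ^ 2 + 1, by positivity, ?_⟩
  intro q F _ _ hq hodd f _ hdeg
  subst hq
  have h1 := NEPO_approx f
  have h2 := T_bound f hodd
  rw [hdeg] at h2
  refine h1.trans ((add_le_add_right h2 _).trans ?_)
  have e : 2 * (n + 1) - 1 = 2 * n + 1 := by omega
  rw [e]
  have a1 : (0 : ℝ) ≤ (Set.ncard (badSet f) : ℝ) * (Fintype.card F : ℝ) ^ 2 := by positivity
  have a2 : (0 : ℝ) ≤ (Fintype.card F : ℝ) ^ (2 * n + 1) := by positivity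
  have a3 : (0 : ℝ) ≤ (2 * ((n : ℝ) + 1)) ^ 2 + (24 * ((2 ^ n * d : ℕ) : ℝ) + 40) ^ 2 := by positivity
  push_cast at a3 ⊢
  nlinarith [mul_nonneg a3 a1]
end

section
/- Let q be an odd prime power, let 2 ≤ k ≤ m be integers, and let f ∈ F_q[x_1,…,x_k] be an admissible symmetric polynomial of total degree d. For each k-element subset I = {i_1 < i_2 < ⋯ < i_k} of {1,…,m}, define f_I ∈ F_q[x_1,…,x_m] by f_I(x_1,…,x_m) = f(x_{i_1}, x_{i_2}, …, x_{i_k}). Then for every nonempty collection T of k-element subsets of {1,…,m}, the polynomial ∏_{I ∈ T} f_I is not a constant multiple of the square of a polynomial in F_q[x_1,…,x_m]. -/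
open MvPolynomial

lemma exists_zero_aux {F : Type} [Field F] {m : ℕ} (p : MvPolynomial (Fin m) F) (hp : ¬ IsUnit p) :
    ∃ z : Fin m → AlgebraicClosure F, aeval z p = 0 := by
  obtain ⟨M, hM, hpM⟩ := exists_max_ideal_of_mem_nonunits hp
  obtain ⟨z, rfl⟩ := MvPolynomial.eq_vanishingIdeal_singleton_of_isMaximal (AlgebraicClosure F) hM
  exact ⟨z, (MvPolynomial.mem_vanishingIdeal_singleton_iff z p).1 hpM⟩

lemma subst_aux {F : Type} [Field F] {k m : ℕ} (hk : 2 ≤ k)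
    (f : MvPolynomial (Fin k) F) (hsym : f.IsSymmetric)
    (hadm : Admissible f) (σ : Fin k → Fin m) (hσ : Function.Injective σ) (j : Fin k)
    (z : Fin m → AlgebraicClosure F) :
    aeval (fun l => if l = σ j then (Polynomial.X : Polynomial (AlgebraicClosure F))
      else Polynomial.C (z l)) (rename σ f) ≠ 0 := by
  let e : Equiv.Perm (Fin k) := Equiv.swap ⟨0, by omega⟩ j
  have h := hadm.2 (fun n => z (σ (e ⟨n.1 + 1, by omega⟩)))
  intro h0
  apply h
  unfold substX
  rw [← hsym e, rename_rename, aeval_rename] at h0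
  rw [← h0, aeval_map_algebraMap]
  congr 2
  funext i
  have hi : (σ (e i) = σ j) ↔ (i : ℕ) = 0 := by
    rw [hσ.eq_iff, Equiv.swap_apply_eq_iff, Equiv.swap_apply_right, Fin.ext_iff]
  simp only [Function.comp, hi]
  split_ifs with h1
  · rfl
  · congr 4
    apply Fin.ext
    simp
    omega

lemma relprime_aux {F : Type} [Field F] {k m : ℕ} (hk : 2 ≤ k)
    (f : MvPolynomial (Fin k) F) (hf : f ≠ 0) (hsym : f.IsSymmetric)
    (hadm : Admissible f) (σ τ : Fin k → Fin m) (hσ : Function.Injective σ)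
    (hτ : Function.Injective τ) (j : Fin k) (hj : ∀ l, τ l ≠ σ j) :
    IsRelPrime (rename σ f) (rename τ f) := by
  intro p hp1 hp2
  by_contra hu
  obtain ⟨z, hz⟩ := exists_zero_aux p hu
  apply subst_aux hk f hsym hadm σ hσ j z
  let ψ : MvPolynomial (Fin m) F →ₐ[F] Polynomial (MvPolynomial (Fin m) F) :=
    aeval (fun l => if l = σ j then Polynomial.X else Polynomial.C (X l))
  have h1 : ψ (rename τ f) = Polynomial.C (rename τ f) := by
    have : ψ.comp (rename τ) =
        (Polynomial.CAlgHom (R := F) (A := MvPolynomial (Fin m) F)).comp (rename τ) := by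
      ext l : 1
      simp [ψ, hj]
    exact AlgHom.congr_fun this f
  have h2 : rename τ f ≠ 0 := by
    rw [Ne, rename_eq_zero_iff_of_injective _ hτ]; exact hf
  have h3 : (ψ p).natDegree = 0 := by
    have hd : ψ p ∣ ψ (rename τ f) := map_dvd ψ hp2
    have := Polynomial.natDegree_le_of_dvd hd (by rw [h1]; simpa using h2)
    rw [h1, Polynomial.natDegree_C] at this
    omega
  obtain ⟨a, ha⟩ := Polynomial.natDegree_eq_zero.1 h3
  have h4 : ∀ r : MvPolynomial (Fin m) F,
      aeval (fun l => if l = σ j then (Polynomial.X : Polynomial (AlgebraicClosure F))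
      else Polynomial.C (z l)) r = Polynomial.mapAlgHom (aeval z) (ψ r) := by
    intro r
    have : (aeval (fun l => if l = σ j then (Polynomial.X : Polynomial (AlgebraicClosure F))
      else Polynomial.C (z l)) : MvPolynomial (Fin m) F →ₐ[F] _) =
        (Polynomial.mapAlgHom (aeval z)).comp ψ := by
      ext l : 1
      simp only [ψ, AlgHom.comp_apply, aeval_X]
      split_ifs <;> simp
    exact AlgHom.congr_fun this r
  have h5 : ∀ r : MvPolynomial (Fin m) F,
      aeval z r = Polynomial.eval (z (σ j)) (Polynomial.mapAlgHom (aeval z) (ψ r)) := by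
    intro r
    have : (aeval z : MvPolynomial (Fin m) F →ₐ[F] _) =
        ((Polynomial.aeval (R := AlgebraicClosure F) (z (σ j))).restrictScalars F).comp
          ((Polynomial.mapAlgHom (aeval z)).comp ψ) := by
      ext l : 1
      simp only [ψ, AlgHom.comp_apply, aeval_X]
      split_ifs with h <;> simp [h]
    simpa [Polynomial.coe_aeval_eq_eval] using AlgHom.congr_fun this r
  have h6 : aeval (fun l => if l = σ j then (Polynomial.X : Polynomial (AlgebraicClosure F))
      else Polynomial.C (z l)) p = 0 := by
    have hC : Polynomial.mapAlgHom (aeval z) (Polynomial.C a) = Polynomial.C (aeval z a) :=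
      Polynomial.map_C _
    have := h5 p
    rw [← ha, hz, hC, Polynomial.eval_C] at this
    rw [h4, ← ha, hC, ← this, Polynomial.C_0]
  obtain ⟨r, hr⟩ := hp1
  rw [hr, map_mul, h6, zero_mul]

theorem stmt_10 (q k m d : ℕ) (F : Type) [Field F] [Fintype F]
    (hF : Fintype.card F = q) (hq : Odd q) (hk : 2 ≤ k) (hkm : k ≤ m)
    (f : MvPolynomial (Fin k) F) (hsym : f.IsSymmetric) (hdeg : f.totalDegree = d)
    (hadm : Admissible f) :
    ∀ T : Finset (Finset (Fin m)), T.Nonempty →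
      ∀ hT : ∀ I ∈ T, I.card = k,
        ¬ ∃ (c : F) (g : MvPolynomial (Fin m) F),
          (∏ I ∈ T.attach, MvPolynomial.rename
              (fun j : Fin k => ((I.1.orderIsoOfFin (hT I.1 I.2)) j : Fin m)) f) =
            MvPolynomial.C c * g ^ 2 := by
  classical
  intro T ⟨I₀, hI₀⟩ hT ⟨c, g, h⟩
  have hf : f ≠ 0 := fun h0 => hadm.1 ⟨0, 0, by simp [h0]⟩
  let σ : {I // I ∈ T} → Fin k → Fin m :=
    fun I j => ((I.1.orderIsoOfFin (hT I.1 I.2)) j : Fin m)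
  have hσ : ∀ I, Function.Injective (σ I) := fun I a b hab =>
    (I.1.orderIsoOfFin (hT I.1 I.2)).injective (Subtype.ext hab)
  change ∏ I ∈ T.attach, rename (σ I) f = _ at h
  have hc : c ≠ 0 := by
    rintro rfl
    rw [map_zero, zero_mul, Finset.prod_eq_zero_iff] at h
    obtain ⟨I, -, hI⟩ := h
    exact hf ((rename_eq_zero_iff_of_injective _ (hσ I)).1 hI)
  have hrel : ∀ I J, I ≠ J → IsRelPrime (rename (σ I) f) (rename (σ J) f) := by
    intro I J hIJ
    have : ¬ I.1 ⊆ J.1 := fun hs => hIJ (Subtype.ext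
      (Finset.eq_of_subset_of_card_le hs (by rw [hT _ I.2, hT _ J.2])))
    obtain ⟨i, hi, hiJ⟩ := Finset.not_subset.1 this
    obtain ⟨j, hj⟩ := (I.1.orderIsoOfFin (hT I.1 I.2)).surjective ⟨i, hi⟩
    have hj' : σ I j = i := congrArg Subtype.val hj
    refine relprime_aux hk f hf hsym hadm (σ I) (σ J) (hσ I) (hσ J) j ?_
    intro l hl
    apply hiJ
    rw [← hj', ← hl]
    exact ((J.1.orderIsoOfFin (hT J.1 J.2)) l).2
  let I : {I // I ∈ T} := ⟨I₀, hI₀⟩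
  rw [← Finset.mul_prod_erase _ _ (Finset.mem_attach T I)] at h
  have hr : IsRelPrime (rename (σ I) f) (∏ J ∈ T.attach.erase I, rename (σ J) f) :=
    IsRelPrime.prod_right fun J hJ => hrel I J (Finset.ne_of_mem_erase hJ).symm
  have hr' : IsRelPrime (rename (σ I) f)
      (C c⁻¹ * ∏ J ∈ T.attach.erase I, rename (σ J) f) := by
    have hu : IsUnit (C c⁻¹ : MvPolynomial (Fin m) F) := (IsUnit.mk0 _ (inv_ne_zero hc)).map C
    exact (isRelPrime_mul_unit_left_right hu).2 hr
  have h' : rename (σ I) f * (C c⁻¹ * ∏ J ∈ T.attach.erase I, rename (σ J) f) = g ^ 2 := by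
    rw [mul_left_comm, h, ← mul_assoc, ← C_mul, inv_mul_cancel₀ hc, C_1, one_mul]
  letI : GCDMonoid (MvPolynomial (Fin m) F) := UniqueFactorizationMonoid.toGCDMonoid _
  obtain ⟨s, u, hs⟩ := exists_associated_pow_of_mul_eq_pow
    (hr' (gcd_dvd_left _ _) (gcd_dvd_right _ _)) h'
  obtain ⟨b, hb, hbu⟩ := MvPolynomial.isUnit_iff_eq_C_of_isReduced.1 u.isUnit
  apply hadm.1
  refine ⟨b, killCompl (hσ I) s, ?_⟩
  have := congrArg (killCompl (hσ I)) hs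
  rw [killCompl_rename_app, hbu, map_mul, map_pow, killCompl_C] at this
  rw [← this, mul_comm]
end

section
/- Let 2 ≤ k ≤ m be fixed integers. There exists a constant C > 0, depending only on k and m, such that for every odd prime power q and every symmetric polynomial f ∈ F_q[x_1,…,x_k] of total degree d ≥ 1, one has |m!·N(f,m) − S(f,m)| ≤ C·d·q^{m−1}, where N(f,m) is the number of f-Diophantine sets A ⊆ F_q with |A| = m, and S(f,m) is the number of tuples (a_1,…,a_m) ∈ F_q^m such that f(a_{i_1},…,a_{i_k}) is a nonzero square in F_q for every k-element subset {i_1,…,i_k} of {1,…,m}. -/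
open MvPolynomial

lemma aux_zeros {F : Type} [Field F] [Fintype F] [DecidableEq F] (m : ℕ) (hm : 1 ≤ m)
    (p : MvPolynomial (Fin m) F) (hp : p ≠ 0) :
    (Finset.univ.filter (fun a : Fin m → F => eval a p = 0)).card
      ≤ p.totalDegree * Fintype.card F ^ (m - 1) := by
  have h := schwartz_zippel_totalDegree hp (Finset.univ : Finset F)
  have e : Fintype.piFinset (fun _ : Fin m => (Finset.univ : Finset F)) = Finset.univ := by
    ext; simp
  rw [e, Finset.card_univ] at h
  have hq : (0 : ℚ≥0) < Fintype.card F := by exact_mod_cast Fintype.card_pos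
  rw [div_le_div_iff₀ (by positivity) hq] at h
  obtain ⟨n, rfl⟩ : ∃ n, m = n + 1 := ⟨m - 1, by omega⟩
  rw [pow_succ, ← mul_assoc] at h
  have h2 := le_of_mul_le_mul_right h hq
  simp only [Nat.add_sub_cancel]
  exact_mod_cast h2

lemma aux_fact {F : Type} [Field F] [Fintype F] [DecidableEq F] (m : ℕ) (A : Finset F)
    (hA : A.card = m) :
    (Finset.univ.filter (fun a : Fin m → F => Function.Injective a ∧
      Finset.univ.image a = A)).card = m.factorial := by
  have h : Fintype.card (Fin m ↪ A) = m.factorial := by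
    rw [Fintype.card_embedding_eq]; simp [hA, Nat.descFactorial_self]
  rw [← h, ← Finset.card_univ]
  symm
  apply Finset.card_bij (fun (e : Fin m ↪ A) _ => fun i => (e i : F))
  · intro e _
    have hi : Function.Injective (fun i => (e i : F)) :=
      Subtype.val_injective.comp e.injective
    simp only [Finset.mem_filter, Finset.mem_univ, true_and]
    refine ⟨hi, Finset.eq_of_subset_of_card_le ?_ ?_⟩
    · intro x hx
      simp only [Finset.mem_image, Finset.mem_univ, true_and] at hx
      obtain ⟨i, rfl⟩ := hx
      exact (e i).2
    · rw [Finset.card_image_of_injective _ hi]; simp [hA]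
  · intro e _ e' _ he
    ext i
    exact congrFun he i
  · intro a ha
    simp only [Finset.mem_filter, Finset.mem_univ, true_and] at ha
    obtain ⟨hi, rfl⟩ := ha
    exact ⟨⟨fun i => ⟨a i, Finset.mem_image_of_mem _ (Finset.mem_univ _)⟩,
      fun i j hij => hi (congrArg Subtype.val hij)⟩, Finset.mem_univ _, rfl⟩

theorem stmt_12 (k m : ℕ) (hk : 2 ≤ k) (hkm : k ≤ m) :
    ∃ C : ℝ, 0 < C ∧
      ∀ (q : ℕ) (F : Type) [Field F] [Fintype F],
        Fintype.card F = q → Odd q →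
        ∀ d : ℕ, 1 ≤ d →
        ∀ f : MvPolynomial (Fin k) F, f.IsSymmetric → f.totalDegree = d →
          |(m.factorial : ℝ) *
              (Set.ncard {A : Finset F | A.card = m ∧
                ∀ a : Fin k → F, Function.Injective a → (∀ i, a i ∈ A) →
                  IsSquare (MvPolynomial.eval a f)} : ℝ) -
            (Set.ncard {a : Fin m → F |
                ∀ b : Fin k → Fin m, Function.Injective b →
                  MvPolynomial.eval (fun j => a (b j)) f ≠ 0 ∧
                  IsSquare (MvPolynomial.eval (fun j => a (b j)) f)} : ℝ)| ≤
            C * (d : ℝ) * (q : ℝ) ^ (m - 1) := by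
  classical
  refine ⟨((m * m + m ^ k : ℕ) : ℝ), by norm_cast; have : 0 < m := by omega
                                        positivity, ?_⟩
  intro q F _ _ hq _ d hd f _ hfd
  subst hq
  have hm : 1 ≤ m := by omega
  have hf0 : f ≠ 0 := by rintro rfl; simp at hfd; omega
  set N : Finset (Finset F) := Finset.univ.filter (fun A => A.card = m ∧
                ∀ a : Fin k → F, Function.Injective a → (∀ i, a i ∈ A) →
                  IsSquare (MvPolynomial.eval a f)) with hN
  set S : Finset (Fin m → F) := Finset.univ.filter (fun a =>
                ∀ b : Fin k → Fin m, Function.Injective b →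
                  MvPolynomial.eval (fun j => a (b j)) f ≠ 0 ∧
                  IsSquare (MvPolynomial.eval (fun j => a (b j)) f)) with hS
  set D : Finset (Fin m → F) := Finset.univ.filter (fun a => Function.Injective a ∧
                ∀ b : Fin k → Fin m, Function.Injective b →
                  IsSquare (MvPolynomial.eval (fun j => a (b j)) f)) with hD
  have eN : Set.ncard {A : Finset F | A.card = m ∧
                ∀ a : Fin k → F, Function.Injective a → (∀ i, a i ∈ A) →
                  IsSquare (MvPolynomial.eval a f)} = N.card := by
    rw [← Set.ncard_coe_finset]; congr 1; ext; simp [hN]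
  have eS : Set.ncard {a : Fin m → F |
                ∀ b : Fin k → Fin m, Function.Injective b →
                  MvPolynomial.eval (fun j => a (b j)) f ≠ 0 ∧
                  IsSquare (MvPolynomial.eval (fun j => a (b j)) f)} = S.card := by
    rw [← Set.ncard_coe_finset]; congr 1; ext; simp [hS]
  rw [eN, eS]
  have key : ∀ a : Fin m → F, Function.Injective a →
      ((∀ b : Fin k → Fin m, Function.Injective b →
          IsSquare (MvPolynomial.eval (fun j => a (b j)) f)) ↔
        Finset.univ.image a ∈ N) := by
    intro a ha
    simp only [hN, Finset.mem_filter, Finset.mem_univ, true_and]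
    constructor
    · intro h
      refine ⟨by rw [Finset.card_image_of_injective _ ha]; simp, ?_⟩
      intro c hc hmem
      simp only [Finset.mem_image, Finset.mem_univ, true_and] at hmem
      choose b hb using hmem
      have := h b (fun i j hij => hc (by rw [← hb, ← hb, hij]))
      simpa only [hb] using this
    · rintro ⟨_, h⟩ b hb
      exact h _ (ha.comp hb) (fun i => Finset.mem_image_of_mem _ (Finset.mem_univ _))
  have eD : D.card = m.factorial * N.card := by
    rw [Finset.card_eq_sum_card_fiberwise (f := fun a => Finset.univ.image a) (t := N)]
    · rw [Finset.sum_congr rfl (g := fun _ => m.factorial)]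
      · simp [mul_comm]
      · intro A hA
        have hA' := hA
        simp only [hN, Finset.mem_filter, Finset.mem_univ, true_and] at hA'
        rw [← aux_fact m A hA'.1]
        congr 1
        ext a
        simp only [hD, Finset.mem_filter, Finset.mem_univ, true_and]
        constructor
        · rintro ⟨⟨h1, _⟩, h2⟩; exact ⟨h1, h2⟩
        · rintro ⟨h1, h2⟩; exact ⟨⟨h1, (key a h1).2 (h2 ▸ hA)⟩, h2⟩
    · intro a ha
      have ha' : a ∈ D := ha
      simp only [hD, Finset.mem_filter, Finset.mem_univ, true_and] at ha'
      exact (key a ha'.1).1 ha'.2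
  have b1 : (D \ S).card ≤ m ^ k * (d * Fintype.card F ^ (m - 1)) := by
    have hsub : D \ S ⊆ (Finset.univ.filter
        (fun b : Fin k → Fin m => Function.Injective b)).biUnion (fun b =>
        Finset.univ.filter (fun a : Fin m → F => eval a (rename b f) = 0)) := by
      intro a ha
      simp only [hD, hS, Finset.mem_sdiff, Finset.mem_filter, Finset.mem_univ, true_and] at ha
      obtain ⟨⟨_, h1⟩, h2⟩ := ha
      push Not at h2
      obtain ⟨b, hb, h3⟩ := h2
      simp only [Finset.mem_biUnion, Finset.mem_filter, Finset.mem_univ, true_and]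
      refine ⟨b, hb, ?_⟩
      rw [eval_rename]
      by_contra h4
      exact h3 h4 (h1 b hb)
    refine (Finset.card_le_card hsub).trans ((Finset.card_biUnion_le_card_mul _ _
      (d * Fintype.card F ^ (m - 1)) ?_).trans ?_)
    · intro b hb
      simp only [Finset.mem_filter, Finset.mem_univ, true_and] at hb
      refine (aux_zeros m hm _ ?_).trans ?_
      · exact fun h => hf0 (rename_injective b hb (by simpa using h))
      · gcongr
        rw [← hfd]
        exact totalDegree_rename_le _ _
    · gcongr
      refine (Finset.card_filter_le _ _).trans ?_
      simp
  have b2 : (S \ D).card ≤ (m * m) * (d * Fintype.card F ^ (m - 1)) := by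
    have hsub : S \ D ⊆ (Finset.univ.filter
        (fun b : Fin m × Fin m => b.1 ≠ b.2)).biUnion (fun b =>
        Finset.univ.filter (fun a : Fin m → F => eval a (X b.1 - X b.2 : MvPolynomial (Fin m) F) = 0)) := by
      intro a ha
      simp only [hD, hS, Finset.mem_sdiff, Finset.mem_filter, Finset.mem_univ, true_and] at ha
      obtain ⟨h1, h2⟩ := ha
      have h3 : ¬ Function.Injective a := fun h => h2 ⟨h, fun b hb => (h1 b hb).2⟩
      simp only [Function.Injective] at h3
      push Not at h3
      obtain ⟨i, j, hij, hne⟩ := h3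
      simp only [Finset.mem_biUnion, Finset.mem_filter, Finset.mem_univ, true_and]
      exact ⟨(i, j), hne, by simp [hij]⟩
    refine (Finset.card_le_card hsub).trans ((Finset.card_biUnion_le_card_mul _ _
      (d * Fintype.card F ^ (m - 1)) ?_).trans ?_)
    · intro b hb
      simp only [Finset.mem_filter, Finset.mem_univ, true_and] at hb
      refine (aux_zeros m hm _ ?_).trans ?_
      · intro h
        exact hb (X_injective (sub_eq_zero.1 h))
      · gcongr
        refine (totalDegree_sub _ _).trans ?_
        simpa using hd
    · gcongr
      refine (Finset.card_filter_le _ _).trans ?_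
      simp
  have c1 := Finset.card_le_card_sdiff_add_card (s := D) (t := S)
  have c2 := Finset.card_le_card_sdiff_add_card (s := S) (t := D)
  have e : (m.factorial : ℝ) * (N.card : ℝ) = (D.card : ℝ) := by rw [eD]; push_cast; rfl
  rw [e]
  have t1 : D.card ≤ (m * m + m ^ k) * (d * Fintype.card F ^ (m - 1)) + S.card := by
    rw [add_mul]; omega
  have t2 : S.card ≤ (m * m + m ^ k) * (d * Fintype.card F ^ (m - 1)) + D.card := by
    rw [add_mul]; omega
  have t1' : (D.card : ℝ) ≤ ((m * m + m ^ k : ℕ) : ℝ) * (d * (Fintype.card F : ℝ) ^ (m - 1)) + S.card := by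
    exact_mod_cast t1
  have t2' : (S.card : ℝ) ≤ ((m * m + m ^ k : ℕ) : ℝ) * (d * (Fintype.card F : ℝ) ^ (m - 1)) + D.card := by
    exact_mod_cast t2
  rw [mul_assoc, abs_le]
  constructor <;> linarith
end
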